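/- arXiv:2104.12397 — 5 statements merged into one kernel-verified Lean document; each statement's English description precedes it below -/
import Mathlib

section
/- Let (y(j))_{j≥1} be a sequence with values in {0,1} such that lim_{n→∞} (1/n) Σ_{j=1}^n y(j) = a for some a > 0, and let (k_r)_{r≥1} be the strictly increasing enumeration of the indices j with y(j) = 1. Then for every δ > 0 there exists n(δ) such that for all n ≥ n(δ) one has k_{r+1} − k_r ≤ δ·n for every r ∈ {1,…,n}. -/
open Filter Topology

/-- If `k` enumerates increasingly the indices `j ≥ 1` with `y j = 1`, then the partial sum of
`y` up to `k r` is `r`. -/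
lemma sum_Icc_enumeration_eq {y : ℕ → ℝ} {k : ℕ → ℕ}
    (hy01 : ∀ j, y j = 0 ∨ y j = 1) (hk : StrictMonoOn k (Set.Ici 1))
    (hmem : ∀ r, 1 ≤ r → 1 ≤ k r ∧ y (k r) = 1)
    (hsurj : ∀ j, 1 ≤ j → y j = 1 → ∃ r, 1 ≤ r ∧ k r = j) {r : ℕ} (hr : 1 ≤ r) :
    ∑ j ∈ Finset.Icc 1 (k r), y j = r := by
  classical
  have hsub : (Finset.Icc 1 r).image k ⊆ Finset.Icc 1 (k r) := by
    intro j hj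
    obtain ⟨s, hs, rfl⟩ := Finset.mem_image.1 hj
    rw [Finset.mem_Icc] at hs ⊢
    exact ⟨(hmem s hs.1).1, hk.monotoneOn hs.1 hr hs.2⟩
  have hzero : ∀ j ∈ Finset.Icc 1 (k r), j ∉ (Finset.Icc 1 r).image k → y j = 0 := by
    intro j hj hj'
    rw [Finset.mem_Icc] at hj
    refine (hy01 j).resolve_right fun h => hj' ?_
    obtain ⟨s, hs, rfl⟩ := hsurj j hj.1 h
    exact Finset.mem_image_of_mem k (Finset.mem_Icc.2 ⟨hs, (hk.le_iff_le hs hr).1 hj.2⟩)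
  rw [← Finset.sum_subset hsub hzero, Finset.sum_image]
  · rw [Finset.sum_congr rfl fun s hs => (hmem s (Finset.mem_Icc.1 hs).1).2]
    simp
  · intro s hs t ht hst
    exact hk.injOn (Finset.mem_Icc.1 hs).1 (Finset.mem_Icc.1 ht).1 hst

/-- A sequence that is `o(n)` is, up to index `n`, uniformly bounded by `δ * n` for large `n`. -/
lemma exists_forall_le_mul_of_tendsto_div_zero {d : ℕ → ℝ}
    (hd : Tendsto (fun n : ℕ => d n / n) atTop (𝓝 0)) {δ : ℝ} (hδ : 0 < δ) :
    ∃ N : ℕ, ∀ n : ℕ, N ≤ n → ∀ r : ℕ, r ≤ n → d r ≤ δ * n := by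
  obtain ⟨R, hR⟩ := eventually_atTop.1 (hd.eventually_lt_const hδ)
  obtain ⟨M, hM⟩ := ((Finset.range (R + 1)).image d).exists_le
  obtain ⟨N, hN⟩ := exists_nat_ge (M / δ)
  refine ⟨N, fun n hn r hr => ?_⟩
  rcases le_or_gt r R with h | h
  · have hMn : M ≤ N * δ := (div_le_iff₀ hδ).1 hN
    have hNn : (N : ℝ) ≤ n := Nat.cast_le.2 hn
    calc d r ≤ M := hM _ (Finset.mem_image_of_mem d (Finset.mem_range.2 (Nat.lt_succ_of_le h)))
      _ ≤ N * δ := hMn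
      _ ≤ δ * n := by rw [mul_comm]; gcongr
  · have hr_pos : (0 : ℝ) < r := Nat.cast_pos.2 (Nat.zero_lt_of_lt h)
    calc d r ≤ δ * r := ((div_lt_iff₀ hr_pos).1 (hR r h.le)).le
      _ ≤ δ * n := by gcongr

/-- If `y : ℕ → {0,1}` has Cesàro mean `a > 0` and `k` enumerates (for indices
`r ≥ 1`, increasingly) the indices `j ≥ 1` with `y j = 1`, then for every `δ > 0` there is
`n(δ)` such that for all `n ≥ n(δ)` and all `1 ≤ r ≤ n` one has `k (r+1) - k r ≤ δ * n`. -/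
theorem quenched_fclt_stmt0 (y : ℕ → ℝ) (a : ℝ) (ha : 0 < a)
    (hy01 : ∀ j, y j = 0 ∨ y j = 1)
    (hcesaro : Tendsto (fun n : ℕ => (∑ j ∈ Finset.Icc 1 n, y j) / n) atTop (𝓝 a))
    (k : ℕ → ℕ)
    (hmono : ∀ r, 1 ≤ r → k r < k (r + 1))
    (hmem : ∀ r, 1 ≤ r → 1 ≤ k r ∧ y (k r) = 1)
    (hsurj : ∀ j, 1 ≤ j → y j = 1 → ∃ r, 1 ≤ r ∧ k r = j) :
    ∀ δ : ℝ, 0 < δ → ∃ N : ℕ, ∀ n : ℕ, N ≤ n → ∀ r : ℕ, 1 ≤ r → r ≤ n →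
      (k (r + 1) : ℝ) - (k r : ℝ) ≤ δ * n := by
  intro δ hδ
  have hshift : StrictMono fun i => k (i + 1) :=
    strictMono_nat_of_lt_succ fun i => hmono (i + 1) (Nat.le_add_left 1 i)
  have hk : StrictMonoOn k (Set.Ici 1) := by
    intro s hs t ht hst
    obtain ⟨s, rfl⟩ := Nat.exists_eq_add_of_le' (Set.mem_Ici.1 hs)
    obtain ⟨t, rfl⟩ := Nat.exists_eq_add_of_le' (Set.mem_Ici.1 ht)
    exact hshift (Nat.lt_of_add_lt_add_right hst)
  have hk_top : Tendsto k atTop atTop := (tendsto_add_atTop_iff_nat 1).1 hshift.tendsto_atTop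
  have hdiv : Tendsto (fun r : ℕ => (k r : ℝ) / r) atTop (𝓝 a⁻¹) := by
    refine ((hcesaro.comp hk_top).inv₀ ha.ne').congr' ?_
    filter_upwards [eventually_ge_atTop 1] with r hr
    simp only [Function.comp_apply, sum_Icc_enumeration_eq hy01 hk hmem hsurj hr, inv_div]
  have hratio : Tendsto (fun r : ℕ => ((r + 1 : ℕ) : ℝ) / r) atTop (𝓝 1) := by
    have h := (tendsto_natCast_div_add_atTop (1 : ℝ)).inv₀ one_ne_zero
    simpa using h
  have hdiv_succ : Tendsto (fun r : ℕ => (k (r + 1) : ℝ) / r) atTop (𝓝 a⁻¹) := by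
    have h := ((tendsto_add_atTop_iff_nat 1).2 hdiv).mul hratio
    rw [mul_one] at h
    refine h.congr fun r => ?_
    rw [div_mul_div_cancel₀ (Nat.cast_ne_zero.2 r.succ_ne_zero)]
  have hgap : Tendsto (fun r : ℕ => ((k (r + 1) : ℝ) - k r) / r) atTop (𝓝 0) := by
    simpa only [sub_div, sub_self] using hdiv_succ.sub hdiv
  obtain ⟨N, hN⟩ := exists_forall_le_mul_of_tendsto_div_zero hgap hδ
  exact ⟨N, fun n hn r _ hrn => hN n hn r hrn⟩
end

section
/- Let θ be an ergodic measure-preserving transformation of a probability space (Ω,ℙ) and let Λ ⊆ Ω be measurable with ℙ(Λ) > 0. For ω ∈ Ω let (k_r(ω))_{r≥1} be the strictly increasing enumeration of the integers k ≥ 1 with θ^k ω ∈ Λ. Then for ℙ-a.e. ω: (1) k_n(ω)/n → 1/ℙ(Λ) as n → ∞, and for every sufficiently small δ > 0 there exists n(δ) such that k_{r+1}(ω) − k_r(ω) ≤ δ·n for all r ∈ {1,…,n} and all n ≥ n(δ); (2) for every sufficiently small δ > 0 and all sufficiently large n there exist an integer v < 2/δ and integers 0 ≤ ρ_1 < ρ_2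 < ⋯ < ρ_v ≤ n with ρ_1 ≤ δ·n, n − ρ_v ≤ (3δ/2)·n, θ^{ρ_i} ω ∈ Λ for each i, and (δ/2)·n ≤ ρ_{i+1} − ρ_i ≤ (3δ/2)·n for i = 1,…,v−1. -/
open Filter Topology MeasureTheory

/-- The running maximum `max (0, S₁ g, …, Sₙ g)` of the Birkhoff sums of `g` along `θ`. -/
noncomputable def birkhoffMax {Ω : Type*} (θ : Ω → Ω) (g : Ω → ℝ) : ℕ → Ω → ℝ
  | 0 => fun _ => 0
  | n + 1 => fun ω => max 0 (g ω + birkhoffMax θ g n (θ ω))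

section BirkhoffMax

variable {Ω : Type*} (θ : Ω → Ω) (g : Ω → ℝ)

theorem birkhoffMax_nonneg (n : ℕ) (ω : Ω) : 0 ≤ birkhoffMax θ g n ω := by
  cases n with
  | zero => exact le_rfl
  | succ n => exact le_max_left _ _

theorem birkhoffMax_le_succ (n : ℕ) (ω : Ω) :
    birkhoffMax θ g n ω ≤ birkhoffMax θ g (n + 1) ω := by
  induction n generalizing ω with
  | zero => exact le_max_left _ _
  | succ n ih => exact max_le_max le_rfl (add_le_add le_rfl (ih (θ ω)))

theorem birkhoffSum_le_birkhoffMax (n : ℕ) (ω : Ω) :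
    birkhoffSum θ g n ω ≤ birkhoffMax θ g n ω := by
  induction n generalizing ω with
  | zero => simp [birkhoffMax]
  | succ n ih =>
    rw [birkhoffSum_succ']
    exact (add_le_add le_rfl (ih (θ ω))).trans (le_max_right _ _)

theorem bddAbove_birkhoffMax_comp_iff (ω : Ω) :
    BddAbove (Set.range fun n => birkhoffMax θ g n (θ ω)) ↔
      BddAbove (Set.range fun n => birkhoffMax θ g n ω) := by
  constructor
  · rintro ⟨C, hC⟩
    refine ⟨max 0 (g ω + C), ?_⟩
    rintro _ ⟨n, rfl⟩
    refine (birkhoffMax_le_succ θ g n ω).trans ?_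
    exact max_le_max le_rfl (add_le_add le_rfl (hC ⟨n, rfl⟩))
  · rintro ⟨C, hC⟩
    refine ⟨C - g ω, ?_⟩
    rintro _ ⟨n, rfl⟩
    have h : g ω + birkhoffMax θ g n (θ ω) ≤ C :=
      (le_max_right _ _).trans (hC ⟨n + 1, rfl⟩)
    dsimp only
    linarith

variable {θ g} [MeasurableSpace Ω]

theorem measurable_birkhoffMax (hθ : Measurable θ) (hg : Measurable g) (n : ℕ) :
    Measurable (birkhoffMax θ g n) := by
  induction n with
  | zero => exact measurable_const
  | succ n ih => exact measurable_const.max (hg.add (ih.comp hθ))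

theorem MeasureTheory.MeasurePreserving.integrable_birkhoffMax {μ : Measure Ω}
    (hθ : MeasurePreserving θ μ μ) (hg : Integrable g μ) (n : ℕ) :
    Integrable (birkhoffMax θ g n) μ := by
  induction n with
  | zero => exact integrable_zero _ _ _
  | succ n ih =>
    exact (integrable_zero _ _ _).sup (hg.add (hθ.integrable_comp_of_integrable ih))

/-- If the running maxima of the Birkhoff sums are a.e. unbounded, the integral is nonnegative. -/
theorem integral_nonneg_of_not_bddAbove_birkhoffMax {μ : Measure Ω}
    (hθ : MeasurePreserving θ μ μ) (hg : Integrable g μ)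
    (h : ∀ᵐ ω ∂μ, ¬ BddAbove (Set.range fun n => birkhoffMax θ g n ω)) :
    0 ≤ ∫ ω, g ω ∂μ := by
  have hM := hθ.integrable_birkhoffMax hg
  have hMθ (n : ℕ) : Integrable (fun ω => birkhoffMax θ g n (θ ω)) μ :=
    hθ.integrable_comp_of_integrable (hM n)
  have hdiff (n : ℕ) (ω : Ω) :
      birkhoffMax θ g (n + 1) ω - birkhoffMax θ g n (θ ω) =
        max (-birkhoffMax θ g n (θ ω)) (g ω) := by
    simp only [birkhoffMax]
    rw [← max_sub_sub_right]
    simp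
  have hlim : Tendsto (fun n => ∫ ω, max (-birkhoffMax θ g n (θ ω)) (g ω) ∂μ) atTop
      (𝓝 (∫ ω, g ω ∂μ)) := by
    refine tendsto_integral_of_dominated_convergence (fun ω => ‖g ω‖) (fun n => ?_) hg.norm
      (fun n => ?_) ?_
    · exact ((hMθ n).neg.sup hg).aestronglyMeasurable
    · refine Eventually.of_forall fun ω => ?_
      have := birkhoffMax_nonneg θ g n (θ ω)
      rw [Real.norm_eq_abs, Real.norm_eq_abs, abs_le]
      exact ⟨(neg_abs_le _).trans (le_max_right _ _),
        max_le ((neg_nonpos.2 this).trans (abs_nonneg _)) (le_abs_self _)⟩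
    · filter_upwards [h] with ω hω
      rw [← bddAbove_birkhoffMax_comp_iff] at hω
      have htop := tendsto_atTop_atTop_of_monotone'
        (monotone_nat_of_le_succ fun n => birkhoffMax_le_succ θ g n (θ ω)) hω
      refine tendsto_const_nhds.congr' ?_
      filter_upwards [htop.eventually_ge_atTop (-g ω)] with n hn
      exact (max_eq_right (by linarith)).symm
  refine ge_of_tendsto' hlim fun n => ?_
  simp_rw [← hdiff]
  have hcomp : ∫ ω, birkhoffMax θ g n (θ ω) ∂μ = ∫ ω, birkhoffMax θ g n ω ∂μ := by
    rw [← integral_map hθ.aemeasurable (hθ.map_eq.symm ▸ (hM n).1), hθ.map_eq]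
  rw [integral_sub (hM _) (hMθ n), hcomp, sub_nonneg]
  exact integral_mono (hM _) (hM _) fun ω => birkhoffMax_le_succ θ g n ω

/-- The Birkhoff sums of a function with negative integral are a.e. bounded above. -/
theorem Ergodic.ae_bddAbove_birkhoffSum {μ : Measure Ω}
    (hθ : Ergodic θ μ) (hgm : Measurable g) (hg : Integrable g μ) (hneg : ∫ ω, g ω ∂μ < 0) :
    ∀ᵐ ω ∂μ, BddAbove (Set.range fun n => birkhoffSum θ g n ω) := by
  have hmeas : MeasurableSet {ω | BddAbove (Set.range fun n => birkhoffMax θ g n ω)} :=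
    measurableSet_bddAbove_range fun n => measurable_birkhoffMax hθ.measurable hgm n
  rcases hθ.ae_mem_or_ae_notMem hmeas (Set.ext fun ω => bddAbove_birkhoffMax_comp_iff θ g ω)
    with h | h
  · filter_upwards [h] with ω hω
    obtain ⟨C, hC⟩ := hω
    refine ⟨C, ?_⟩
    rintro _ ⟨n, rfl⟩
    exact (birkhoffSum_le_birkhoffMax θ g n ω).trans (hC ⟨n, rfl⟩)
  · exact absurd (integral_nonneg_of_not_bddAbove_birkhoffMax hθ.toMeasurePreserving hg h)
      hneg.not_ge

theorem Ergodic.ae_eventually_birkhoffSum_le {μ : Measure Ω} [IsProbabilityMeasure μ]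
    (hθ : Ergodic θ μ) (hgm : Measurable g) (hg : Integrable g μ) {a : ℝ}
    (ha : ∫ ω, g ω ∂μ < a) :
    ∀ᵐ ω ∂μ, ∀ᶠ n : ℕ in atTop, birkhoffSum θ g n ω ≤ a * n := by
  obtain ⟨b, hb, hba⟩ := exists_between ha
  have hneg : ∫ ω, (g ω - b) ∂μ < 0 := by
    rw [integral_sub hg (integrable_const b)]
    simpa using hb
  filter_upwards [hθ.ae_bddAbove_birkhoffSum (hgm.sub_const b) (hg.sub (integrable_const b)) hneg]
    with ω hω
  obtain ⟨C, hC⟩ := hω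
  filter_upwards [(tendsto_natCast_atTop_atTop.const_mul_atTop (sub_pos.2 hba)).eventually_ge_atTop
    C] with n hn
  have h : birkhoffSum θ (fun ω => g ω - b) n ω ≤ C := hC ⟨n, rfl⟩
  have hsum : birkhoffSum θ (fun ω => g ω - b) n ω = birkhoffSum θ g n ω - n * b := by
    simp [birkhoffSum]
  rw [hsum] at h
  linarith

/-- **Birkhoff's pointwise ergodic theorem** for an ergodic map of a probability space. -/
theorem Ergodic.ae_tendsto_birkhoffSum_div {μ : Measure Ω} [IsProbabilityMeasure μ]
    (hθ : Ergodic θ μ) (hgm : Measurable g) (hg : Integrable g μ) :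
    ∀ᵐ ω ∂μ, Tendsto (fun n : ℕ => birkhoffSum θ g n ω / n) atTop (𝓝 (∫ ω, g ω ∂μ)) := by
  have hupper : ∀ᵐ ω ∂μ, ∀ i : ℕ, ∀ᶠ n : ℕ in atTop,
      birkhoffSum θ g n ω ≤ (∫ ω, g ω ∂μ + 1 / ((i : ℝ) + 1)) * n :=
    ae_all_iff.2 fun i => hθ.ae_eventually_birkhoffSum_le hgm hg
      (lt_add_of_pos_right _ Nat.one_div_pos_of_nat)
  have hlower : ∀ᵐ ω ∂μ, ∀ i : ℕ, ∀ᶠ n : ℕ in atTop,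
      birkhoffSum θ (-g) n ω ≤ (-∫ ω, g ω ∂μ + 1 / ((i : ℝ) + 1)) * n := by
    refine ae_all_iff.2 fun i => hθ.ae_eventually_birkhoffSum_le hgm.neg hg.neg ?_
    rw [integral_neg']
    exact lt_add_of_pos_right _ Nat.one_div_pos_of_nat
  filter_upwards [hupper, hlower] with ω hu hl
  rw [Metric.tendsto_nhds]
  intro ε hε
  obtain ⟨i, hi⟩ := exists_nat_one_div_lt hε
  filter_upwards [hu i, hl i, eventually_gt_atTop 0] with n hun hln hn
  have hn' : (0 : ℝ) < n := Nat.cast_pos.2 hn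
  rw [birkhoffSum_neg] at hln
  rw [Real.dist_eq]
  refine lt_of_le_of_lt ?_ hi
  rw [abs_le, neg_le_sub_iff_le_add, sub_le_iff_le_add', ← sub_le_iff_le_add, le_div_iff₀ hn',
    div_le_iff₀ hn']
  constructor <;> linarith

end BirkhoffMax

section Enumeration

variable {κ : ℕ → ℕ}

theorem card_filter_range_of_enumeration {V : Set ℕ} [DecidablePred (· ∈ V)]
    (hmono : ∀ r, 1 ≤ r → κ r < κ (r + 1)) (hmem : ∀ r, 1 ≤ r → 1 ≤ κ r ∧ κ r ∈ V)
    (hsurj : ∀ j, 1 ≤ j → j ∈ V → ∃ r, 1 ≤ r ∧ κ r = j) {n : ℕ} (hn : 1 ≤ n) :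
    ((Finset.range (κ n)).filter fun j => j + 1 ∈ V).card = n := by
  have hstrict : StrictMonoOn κ (Set.Ici 1) :=
    strictMonoOn_of_lt_add_one Set.ordConnected_Ici fun r _ hr _ => hmono r hr
  have himage : (Finset.Icc 1 n).image (fun r => κ r - 1) =
      (Finset.range (κ n)).filter fun j => j + 1 ∈ V := by
    ext j
    simp only [Finset.mem_image, Finset.mem_Icc, Finset.mem_filter, Finset.mem_range]
    constructor
    · rintro ⟨r, ⟨hr, hrn⟩, rfl⟩
      have hle := hstrict.monotoneOn hr hn hrn
      obtain ⟨hpos, hV⟩ := hmem r hr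
      rw [Nat.sub_add_cancel hpos]
      exact ⟨by omega, hV⟩
    · rintro ⟨hj, hV⟩
      obtain ⟨r, hr, hrj⟩ := hsurj (j + 1) (by omega) hV
      exact ⟨r, ⟨hr, (hstrict.le_iff_le hr hn).1 (by omega)⟩, by omega⟩
  rw [← himage, Finset.card_image_of_injOn, Nat.card_Icc, Nat.add_sub_cancel]
  intro r hr s hs hrs
  rw [Finset.coe_Icc] at hr hs
  have h1 := (hmem r hr.1).1
  have h2 := (hmem s hs.1).1
  exact hstrict.injOn hr.1 hs.1 (by dsimp only at hrs; omega)

theorem le_of_enumeration (hmono : ∀ r, 1 ≤ r → κ r < κ (r + 1)) (hpos : 1 ≤ κ 1)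
    {r : ℕ} (hr : 1 ≤ r) : r ≤ κ r := by
  induction r, hr using Nat.le_induction with
  | base => exact hpos
  | succ r hr ih => exact Nat.succ_le_of_lt (ih.trans_lt (hmono r hr))

theorem eventually_gap_le_of_tendsto_div {c : ℝ}
    (hlim : Tendsto (fun n : ℕ => (κ n : ℝ) / n) atTop (𝓝 c)) {δ : ℝ} (hδ : 0 < δ) :
    ∀ᶠ r : ℕ in atTop, (κ (r + 1) : ℝ) - κ r ≤ δ * r := by
  have hsucc : Tendsto (fun n : ℕ => (κ (n + 1) : ℝ) / n) atTop (𝓝 c) := by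
    have h1 := hlim.comp (tendsto_add_atTop_nat 1)
    have h2 : Tendsto (fun n : ℕ => 1 + 1 / (n : ℝ)) atTop (𝓝 (1 + 0)) :=
      tendsto_one_div_atTop_nhds_zero_nat.const_add 1
    have h3 := h1.mul h2
    rw [add_zero, mul_one] at h3
    refine h3.congr' ?_
    filter_upwards [eventually_gt_atTop 0] with n hn
    have hn' : (n : ℝ) ≠ 0 := Nat.cast_ne_zero.2 hn.ne'
    simp only [Function.comp_apply]
    push_cast
    field_simp
  have hzero := hsucc.sub hlim
  rw [sub_self] at hzero
  filter_upwards [hzero.eventually_le_const hδ, eventually_gt_atTop 0] with n hn hpos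
  rwa [← sub_div, div_le_iff₀ (Nat.cast_pos.2 hpos)] at hn

theorem eventually_forall_le_mul_of_eventually_le {u : ℕ → ℝ} {δ : ℝ} (hδ : 0 < δ)
    (h : ∀ᶠ r : ℕ in atTop, u r ≤ δ * r) :
    ∀ᶠ n : ℕ in atTop, ∀ r ≤ n, u r ≤ δ * n := by
  obtain ⟨R, hR⟩ := eventually_atTop.1 h
  have hfin : ∀ᶠ n : ℕ in atTop, ∀ r ∈ Finset.range R, u r ≤ δ * n :=
    (Finset.eventually_all _).2 fun r _ =>
      (tendsto_natCast_atTop_atTop.const_mul_atTop hδ).eventually_ge_atTop (u r)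
  filter_upwards [hfin] with n hn r hrn
  rcases lt_or_ge r R with hr | hr
  · exact hn r (Finset.mem_range.2 hr)
  · refine (hR r hr).trans ?_
    gcongr

theorem eventually_exists_le_one_add_mul (hmono : ∀ r, 1 ≤ r → κ r < κ (r + 1)) (hpos : 1 ≤ κ 1)
    (hgap : ∀ δ : ℝ, 0 < δ → ∀ᶠ r : ℕ in atTop, (κ (r + 1) : ℝ) - κ r ≤ δ * r)
    {η : ℝ} (hη : 0 < η) :
    ∀ᶠ m : ℕ in atTop, ∃ r, 1 ≤ r ∧ m ≤ κ r ∧ (κ r : ℝ) ≤ (1 + η) * m := by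
  obtain ⟨R, hR⟩ := eventually_atTop.1 (hgap η hη)
  have hstrict : StrictMonoOn κ (Set.Ici 1) :=
    strictMonoOn_of_lt_add_one Set.ordConnected_Ici fun r _ hr _ => hmono r hr
  filter_upwards [eventually_ge_atTop (κ (R + 1))] with m hm
  have hex : ∃ r, 1 ≤ r ∧ m < κ r :=
    ⟨m + 1, by omega, Nat.lt_of_succ_le (le_of_enumeration hmono hpos (by omega))⟩
  obtain ⟨hs1, hsm⟩ := Nat.find_spec hex
  have hmin := fun {t} => Nat.find_min (m := t) hex
  generalize Nat.find hex = s at hs1 hsm hmin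
  have hRs : R + 1 < s := (hstrict.lt_iff_lt (Set.mem_Ici.2 (by omega)) hs1).1 (hm.trans_lt hsm)
  obtain ⟨r, rfl⟩ : ∃ r, s = r + 1 := ⟨s - 1, by omega⟩
  have hr1 : 1 ≤ r := by omega
  have hrm : κ r ≤ m := by
    by_contra! hlt
    exact hmin (Nat.lt_succ_self r) ⟨hr1, hlt⟩
  refine ⟨r + 1, hs1, hsm.le, ?_⟩
  have h1 := hR r (by omega)
  have h2 : (r : ℝ) ≤ m := by exact_mod_cast (le_of_enumeration hmono hpos hr1).trans hrm
  have h3 : (κ r : ℝ) ≤ m := by exact_mod_cast hrm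
  nlinarith

theorem eventually_exists_spaced {V : Set ℕ}
    (hV : ∀ η : ℝ, 0 < η → ∀ᶠ m : ℕ in atTop, ∃ j ∈ V, m ≤ j ∧ (j : ℝ) ≤ (1 + η) * m)
    {δ : ℝ} (hδ : 0 < δ) (hδ1 : δ ≤ 1) :
    ∀ᶠ n : ℕ in atTop, ∃ v : ℕ, 1 ≤ v ∧ (v : ℝ) < 2 / δ ∧
      ∃ ρ : ℕ → ℕ,
        (∀ i, 1 ≤ i → i < v → ρ i < ρ (i + 1)) ∧
        (ρ 1 : ℝ) ≤ δ * n ∧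
        ρ v ≤ n ∧
        ((n : ℝ) - (ρ v : ℝ)) ≤ (3 * δ / 2) * n ∧
        (∀ i, 1 ≤ i → i ≤ v → ρ i ∈ V) ∧
        (∀ i, 1 ≤ i → i < v →
          (δ / 2) * n ≤ (ρ (i + 1) : ℝ) - (ρ i : ℝ) ∧
          (ρ (i + 1) : ℝ) - (ρ i : ℝ) ≤ (3 * δ / 2) * n) := by
  obtain ⟨M, hM⟩ := eventually_atTop.1 (hV (δ / 8) (by positivity))
  have hlarge := (tendsto_natCast_atTop_atTop (R := ℝ)).const_mul_atTop
    (show 0 < δ / 8 by positivity)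
  filter_upwards [hlarge.eventually_ge_atTop (M : ℝ), hlarge.eventually_ge_atTop 1]
    with n hnM hn1
  have hδn : 0 < δ * n := by linarith
  set v : ℕ := ⌊1 / δ + 1 / 2⌋₊ with hv
  have hinv : 1 ≤ 1 / δ := (one_le_div hδ).2 hδ1
  have hvle : (v : ℝ) ≤ 1 / δ + 1 / 2 := Nat.floor_le (by positivity)
  have hvlt : 1 / δ + 1 / 2 < v + 1 := Nat.lt_floor_add_one _
  have hinvn : 1 / δ * (δ * n) = n := by field_simp
  have hv1 : 1 ≤ v := by
    rw [hv, Nat.le_floor_iff (by positivity)]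
    push_cast
    linarith
  have hvn : ((v : ℝ) - 1 / 2) * (δ * n) ≤ n := by
    calc ((v : ℝ) - 1 / 2) * (δ * n) ≤ 1 / δ * (δ * n) := by gcongr; linarith
      _ = n := hinvn
  have hnv : (n : ℝ) ≤ ((v : ℝ) + 1 / 2) * (δ * n) := by
    calc (n : ℝ) = 1 / δ * (δ * n) := hinvn.symm
      _ ≤ ((v : ℝ) + 1 / 2) * (δ * n) := by gcongr; linarith
  have hexists : ∀ i : ℕ, ∃ j : ℕ, 1 ≤ i → i ≤ v → j ∈ V ∧
      ((i : ℝ) - 3 / 4) * (δ * n) ≤ j ∧ (j : ℝ) ≤ ((i : ℝ) - 1 / 2) * (δ * n) := by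
    intro i
    by_cases hi : 1 ≤ i ∧ i ≤ v
    swap
    · exact ⟨0, fun h1 h2 => absurd ⟨h1, h2⟩ hi⟩
    have hi1 : (1 : ℝ) ≤ i := by exact_mod_cast hi.1
    have hiv : (i : ℝ) ≤ v := by exact_mod_cast hi.2
    have hlow : 1 / 4 * (δ * n) ≤ ((i : ℝ) - 3 / 4) * (δ * n) := by gcongr; linarith
    have hupp : ((i : ℝ) - 1 / 2) * (δ * n) ≤ n := by
      refine le_trans ?_ hvn
      gcongr
    set m : ℕ := ⌈((i : ℝ) - 3 / 4) * (δ * n)⌉₊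
    have hm1 : ((i : ℝ) - 3 / 4) * (δ * n) ≤ m := Nat.le_ceil _
    have hm2 : (m : ℝ) < ((i : ℝ) - 3 / 4) * (δ * n) + 1 := Nat.ceil_lt_add_one (by linarith)
    have hmn : (m : ℝ) ≤ n := by linarith
    obtain ⟨j, hjV, hmj, hj⟩ := hM m (by
      have : (M : ℝ) ≤ m := by linarith
      exact_mod_cast this)
    have hmj' : (m : ℝ) ≤ j := by exact_mod_cast hmj
    have hδm : δ / 8 * m ≤ δ / 8 * n := by gcongr
    exact ⟨j, fun _ _ => ⟨hjV, by linarith, by linarith⟩⟩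
  choose ρ hρ using hexists
  have hgap (i : ℕ) (hi : 1 ≤ i) (hiv : i < v) :
      (δ / 2) * n ≤ (ρ (i + 1) : ℝ) - (ρ i : ℝ) ∧
        (ρ (i + 1) : ℝ) - (ρ i : ℝ) ≤ (3 * δ / 2) * n := by
    obtain ⟨-, h1, h2⟩ := hρ i hi hiv.le
    obtain ⟨-, h3, h4⟩ := hρ (i + 1) (by omega) hiv
    push_cast at h3 h4
    constructor <;> linarith
  refine ⟨v, hv1, ?_, ρ, fun i hi hiv => ?_, ?_, ?_, ?_, fun i hi hiv => (hρ i hi hiv).1, hgap⟩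
  · have : 2 / δ = 1 / δ + 1 / δ := by ring
    linarith
  · have := (hgap i hi hiv).1
    have hlt : (ρ i : ℝ) < ρ (i + 1) := by linarith
    exact_mod_cast hlt
  · have := (hρ 1 le_rfl hv1).2.2
    push_cast at this
    linarith
  · exact_mod_cast (hρ v hv1 le_rfl).2.2.trans hvn
  · have := (hρ v hv1 le_rfl).2.1
    linarith

end Enumeration

/-- For an ergodic transformation `θ` of a probability space and a set `Λ` of
positive measure, the successive visit times `k ω r` of `ω` to `Λ` satisfy, for a.e. `ω`:
`k n / n → 1/ℙ(Λ)`, the gaps are eventually `≤ δ n` for `r ≤ n`, and one can choose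
`v < 2/δ` visit times `ρ_1 < ⋯ < ρ_v ≤ n` which are `δn/2`-to-`3δn/2` spaced. -/
theorem quenched_fclt_stmt1 {Ω : Type*} [MeasurableSpace Ω]
    (P : Measure Ω) [IsProbabilityMeasure P]
    (θ : Ω → Ω) (hθ : Ergodic θ P)
    (Λ : Set Ω) (hΛmeas : MeasurableSet Λ) (hΛpos : 0 < P Λ)
    (k : Ω → ℕ → ℕ)
    (henum : ∀ᵐ ω ∂P,
      (∀ r, 1 ≤ r → k ω r < k ω (r + 1)) ∧
      (∀ r, 1 ≤ r → 1 ≤ k ω r ∧ θ^[k ω r] ω ∈ Λ) ∧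
      (∀ j, 1 ≤ j → θ^[j] ω ∈ Λ → ∃ r, 1 ≤ r ∧ k ω r = j)) :
    ∀ᵐ ω ∂P,
      -- (1) `k n / n → 1/ℙ(Λ)` and the gap bound
      (Tendsto (fun n : ℕ => (k ω n : ℝ) / n) atTop (𝓝 (1 / (P Λ).toReal))) ∧
      (∃ δ₀ : ℝ, 0 < δ₀ ∧ ∀ δ : ℝ, 0 < δ → δ ≤ δ₀ →
        ∃ N : ℕ, ∀ n : ℕ, N ≤ n → ∀ r : ℕ, 1 ≤ r → r ≤ n →
          (k ω (r + 1) : ℝ) - (k ω r : ℝ) ≤ δ * n) ∧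
      -- (2) well-spaced visit times
      (∃ δ₀ : ℝ, 0 < δ₀ ∧ ∀ δ : ℝ, 0 < δ → δ ≤ δ₀ →
        ∃ N : ℕ, ∀ n : ℕ, N ≤ n → ∃ v : ℕ, 1 ≤ v ∧ (v : ℝ) < 2 / δ ∧
          ∃ ρ : ℕ → ℕ,
            (∀ i, 1 ≤ i → i < v → ρ i < ρ (i + 1)) ∧
            (ρ 1 : ℝ) ≤ δ * n ∧
            ρ v ≤ n ∧
            ((n : ℝ) - (ρ v : ℝ)) ≤ (3 * δ / 2) * n ∧
            (∀ i, 1 ≤ i → i ≤ v → θ^[ρ i] ω ∈ Λ) ∧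
            (∀ i, 1 ≤ i → i < v →
              (δ / 2) * n ≤ (ρ (i + 1) : ℝ) - (ρ i : ℝ) ∧
              (ρ (i + 1) : ℝ) - (ρ i : ℝ) ≤ (3 * δ / 2) * n)) := by
  classical
  have hint : Integrable (Λ.indicator (1 : Ω → ℝ)) P :=
    (integrable_const (1 : ℝ)).indicator hΛmeas
  have hbirkhoff := hθ.quasiMeasurePreserving.ae
    (hθ.ae_tendsto_birkhoffSum_div (measurable_one.indicator hΛmeas) hint)
  rw [integral_indicator_one hΛmeas] at hbirkhoff
  have hp : (P Λ).toReal ≠ 0 := (ENNReal.toReal_pos hΛpos.ne' (measure_ne_top P Λ)).ne'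
  filter_upwards [henum, hbirkhoff] with ω ⟨hmono, hmem, hsurj⟩ hω
  have hpos : 1 ≤ k ω 1 := (hmem 1 le_rfl).1
  have hsum (n : ℕ) (hn : 1 ≤ n) :
      birkhoffSum θ (Λ.indicator (1 : Ω → ℝ)) (k ω n) (θ ω) = n := by
    simp only [birkhoffSum, Set.indicator_apply, Pi.one_apply, Finset.sum_boole, Nat.cast_inj,
      ← Function.iterate_succ_apply]
    convert card_filter_range_of_enumeration (V := {j | θ^[j] ω ∈ Λ}) hmono hmem hsurj hn
    exact Iff.rfl
  have htop : Tendsto (k ω) atTop atTop :=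
    tendsto_atTop_mono' _ ((eventually_ge_atTop 1).mono fun r hr =>
      le_of_enumeration hmono hpos hr) tendsto_id
  have hlim : Tendsto (fun n : ℕ => (k ω n : ℝ) / n) atTop (𝓝 (1 / (P Λ).toReal)) := by
    rw [one_div]
    refine ((hω.comp htop).inv₀ hp).congr' ?_
    filter_upwards [eventually_ge_atTop 1] with n hn
    simp [hsum n hn]
  have hgap (δ : ℝ) (hδ : 0 < δ) := eventually_gap_le_of_tendsto_div hlim hδ
  refine ⟨hlim, ⟨1, one_pos, fun δ hδ _ => ?_⟩, ⟨1, one_pos, fun δ hδ hδ1 => ?_⟩⟩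
  · obtain ⟨N, hN⟩ := eventually_atTop.1
      (eventually_forall_le_mul_of_eventually_le hδ (hgap δ hδ))
    exact ⟨N, fun n hn r _ hrn => hN n hn r hrn⟩
  · refine eventually_atTop.1
      (eventually_exists_spaced (V := {j | θ^[j] ω ∈ Λ}) (fun η hη => ?_) hδ hδ1)
    filter_upwards [eventually_exists_le_one_add_mul hmono hpos hgap hη] with m ⟨r, hr, hmr, hrm⟩
    exact ⟨k ω r, (hmem r hr).2, hmr, hrm⟩
end

section
/- Let (𝒳,d) be a metric space and r ≥ 2 an integer. For H = (h_1,…,h_r) ∈ 𝒳^r and nonempty I, J ⊆ {1,…,r}, set d^I(H) := max_{i,j∈I} d(h_i,h_j) and d_{I,J}(H) := min_{i∈I, j∈J} d(h_i,h_j); for a partition Q of {1,…,r} into at least two nonempty blocks, set d^Q(H) := max_{I∈Q} d^I(H) and d_Q(H) := min_{I≠J, I,J∈Q} d_{I,J}(H). For 0 ≤ α < β define Δ(β) := {H : d^{{1,…,r}}(H) ≤ β} and Δ_Q(α,β) := {H : d^Q(H) ≤ α and d_Q(H) > β}. Then for every sequence β_0 = 0 < β_1 < 3β_1 < β_2 <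 ⋯ < β_{r−1} < 3β_{r−1} < β_r, one has 𝒳^r = Δ(β_r) ∪ ⋃_{j=0}^{r−1} ⋃_{Q : |Q| ≥ 2} Δ_Q(3β_j, β_{j+1}). -/
/-- A finite family `Q` of subsets of `Fin r` is a partition of `{1,…,r}` into
nonempty blocks. -/
def IsFinPartition {r : ℕ} (Q : Finset (Finset (Fin r))) : Prop :=
  (∅ ∉ Q) ∧ (∀ I ∈ Q, ∀ J ∈ Q, I ≠ J → Disjoint I J) ∧ (Q.sup id = Finset.univ)

/-- A labelling `f` of the points `H i` whose fibres have diameters bounded by the nonnegative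
weights `w` of their labels. -/
def IsWeightedClustering {ι X : Type*} [PseudoMetricSpace X] (H : ι → X) (f : ι → ι)
    (w : ι → ℝ) : Prop :=
  (∀ a, 0 ≤ w a) ∧ ∀ i j, f i = f j → dist (H i) (H j) ≤ w (f i)

/-- Merging two clusters at distance at most `t` costs at most `t` in total weight. -/
theorem IsWeightedClustering.exists_merge {ι X : Type*} [Fintype ι] [DecidableEq ι]
    [PseudoMetricSpace X] {H : ι → X} {f : ι → ι} {w : ι → ℝ} (h : IsWeightedClustering H f w)
    {t : ℝ} (ht : 0 ≤ t) {p q : ι} (hpq : f p ≠ f q) (hd : dist (H p) (H q) ≤ t) :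
    ∃ f' w', IsWeightedClustering H f' w' ∧
      (Finset.univ.image f').card + 1 ≤ (Finset.univ.image f).card ∧
      ∑ a, w' a ≤ ∑ a, w a + t := by
  obtain ⟨hw, hdiam⟩ := h
  have cross : ∀ i j, f i = f p → f j = f q → dist (H i) (H j) ≤ w (f p) + w (f q) + t := by
    intro i j hi hj
    have h1 := hdiam i p hi
    have h2 := hdiam q j hj.symm
    have h3 := dist_triangle4 (H i) (H p) (H q) (H j)
    rw [hi] at h1
    linarith
  refine ⟨fun i => if f i = f q then f p else f i,
    fun a => w a + (if a = f p then w (f q) + t else 0) - (if a = f q then w (f q) else 0),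
    ⟨?_, ?_⟩, ?_, ?_⟩
  · intro a
    have h1 := hw a
    have h2 := hw (f q)
    dsimp only
    split_ifs with ha hb hb
    · linarith
    · linarith
    · subst hb; linarith
    · linarith
  · intro i j hij
    have hp := hw (f p)
    have hq := hw (f q)
    have hdij := hdiam i j
    dsimp only at hij ⊢
    by_cases hi : f i = f q <;> by_cases hj : f j = f q
    · have := hdij (hi.trans hj.symm)
      simp only [hi, if_true, if_neg hpq] at this ⊢
      linarith
    · simp only [if_pos hi, if_neg hj] at hij
      have := cross j i hij.symm hi
      rw [dist_comm] at this
      simp only [if_pos hi, if_true, if_neg hpq]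
      linarith
    · simp only [if_neg hi, if_pos hj] at hij
      have := cross i j hij hj
      simp only [hij, if_true, if_neg hpq]
      linarith
    · simp only [if_neg hi, if_neg hj] at hij
      have := hdij hij
      simp only [if_neg hi]
      split_ifs <;> linarith
  · have hsub : Finset.univ.image (fun i => if f i = f q then f p else f i) ⊆
        (Finset.univ.image f).erase (f q) := by
      intro a ha
      obtain ⟨i, -, rfl⟩ := Finset.mem_image.1 ha
      split_ifs with hi
      · exact Finset.mem_erase.2 ⟨hpq, Finset.mem_image_of_mem f (Finset.mem_univ p)⟩
      · exact Finset.mem_erase.2 ⟨hi, Finset.mem_image_of_mem f (Finset.mem_univ i)⟩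
    have h1 := Finset.card_le_card hsub
    have h2 := Finset.card_erase_add_one
      (Finset.mem_image_of_mem f (Finset.mem_univ q))
    omega
  · simp only [Finset.sum_sub_distrib, Finset.sum_add_distrib, Finset.sum_ite_eq',
      Finset.mem_univ, if_true]
    linarith

/-- Merging clusters until they are `t`-separated costs at most `t` per lost cluster. -/
theorem IsWeightedClustering.exists_separated {ι X : Type*} [Fintype ι] [DecidableEq ι]
    [PseudoMetricSpace X] {H : ι → X} {t : ℝ} (ht : 0 ≤ t) {f : ι → ι} {w : ι → ℝ}
    (h : IsWeightedClustering H f w) :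
    ∃ f' w', IsWeightedClustering H f' w' ∧ (∀ i j, f' i ≠ f' j → t < dist (H i) (H j)) ∧
      (Finset.univ.image f').card ≤ (Finset.univ.image f).card ∧
      ∑ a, w' a ≤ ∑ a, w a +
        ((Finset.univ.image f).card - (Finset.univ.image f').card : ℝ) * t := by
  induction hn : (Finset.univ.image f).card using Nat.strong_induction_on generalizing f w with
  | _ n ih =>
    by_cases hsep : ∀ i j, f i ≠ f j → t < dist (H i) (H j)
    · exact ⟨f, w, h, hsep, hn.le, by simp [hn]⟩
    · push Not at hsep
      obtain ⟨p, q, hpq, hd⟩ := hsep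
      obtain ⟨g, v, hg, hcard, hsum⟩ := h.exists_merge ht hpq hd
      obtain ⟨f', w', h', hs, hc, hS⟩ := ih _ (by omega) hg rfl
      refine ⟨f', w', h', hs, by omega, ?_⟩
      have : ((Finset.univ.image g).card : ℝ) + 1 ≤ n := by
        rw [hn] at hcard
        exact_mod_cast hcard
      nlinarith [mul_le_mul_of_nonneg_right this ht]

/-- The fibres of a labelling form a partition. -/
theorem isFinPartition_image_fibers {r : ℕ} (f : Fin r → Fin r) :
    IsFinPartition (Finset.univ.image fun i => Finset.univ.filter fun k => f k = f i) := by
  refine ⟨?_, ?_, ?_⟩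
  · intro h
    obtain ⟨i, -, hi⟩ := Finset.mem_image.1 h
    exact Finset.notMem_empty i (hi ▸ Finset.mem_filter.2 ⟨Finset.mem_univ i, rfl⟩)
  · intro I hI J hJ hIJ
    obtain ⟨i, -, rfl⟩ := Finset.mem_image.1 hI
    obtain ⟨j, -, rfl⟩ := Finset.mem_image.1 hJ
    refine Finset.disjoint_left.2 fun k hk hk' => hIJ ?_
    simp only [Finset.mem_filter, Finset.mem_univ, true_and] at hk hk'
    rw [← hk, ← hk']
  · refine Finset.eq_univ_of_forall fun i => ?_
    exact Finset.mem_sup.2 ⟨_, Finset.mem_image_of_mem _ (Finset.mem_univ i), by simp⟩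

/-- **separation of clusters.** For scales
`β₀ = 0 < β₁ < 3β₁ < β₂ < ⋯ < 3β_{r-1} < β_r`, every `r`-tuple `H` of points of a metric
space is either entirely clustered at scale `β_r` (i.e. `H ∈ Δ(β_r)`), or lies in some
`Δ_Q(3β_j, β_{j+1})` for a partition `Q` with at least two blocks: each block has diameter
`≤ 3β_j` and distinct blocks are at distance `> β_{j+1}`. -/
theorem quenched_fclt_stmt11 {𝒳 : Type*} [MetricSpace 𝒳]
    (r : ℕ) (hr : 2 ≤ r)
    (β : ℕ → ℝ) (hβ0 : β 0 = 0) (hβ : ∀ j, j < r → 3 * β j < β (j + 1)) :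
    ∀ H : Fin r → 𝒳,
      (∀ i j, dist (H i) (H j) ≤ β r) ∨
      (∃ j, j < r ∧ ∃ Q : Finset (Finset (Fin r)), IsFinPartition Q ∧ 2 ≤ Q.card ∧
        (∀ I ∈ Q, ∀ i ∈ I, ∀ i' ∈ I, dist (H i) (H i') ≤ 3 * β j) ∧
        (∀ I ∈ Q, ∀ J ∈ Q, I ≠ J → ∀ i ∈ I, ∀ i' ∈ J, β (j + 1) < dist (H i) (H i'))) := by
  intro H
  by_contra hcon
  rw [not_or] at hcon
  obtain ⟨hfar, hnone⟩ := hcon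
  have hnonneg : ∀ j, j ≤ r → 0 ≤ β j := by
    intro j
    induction j with
    | zero => intro _; exact hβ0.ge
    | succ j ih => intro hj; linarith [ih (by omega), hβ j hj]
  have hlast : ∀ j, j < r → 3 * β j ≤ β r := by
    intro j hj
    have key : ∀ k, j + 1 + k ≤ r → 3 * β j ≤ β (j + 1 + k) := by
      intro k
      induction k with
      | zero => intro _; exact (hβ j hj).le
      | succ k ih =>
        intro hk
        have h1 := hβ (j + 1 + k) (by omega)
        have h2 := hnonneg (j + 1 + k) (by omega)
        have h3 := ih (by omega)
        rw [← add_assoc]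
        linarith
    have := key (r - (j + 1)) (by omega)
    rwa [Nat.add_sub_cancel' hj] at this
  have hfail : ∀ j, j < r → ∀ f w, IsWeightedClustering H f w →
      (∀ i k, f i ≠ f k → β (j + 1) < dist (H i) (H k)) → 3 * β j < ∑ a, w a := by
    intro j hj f w ⟨hw, hdiam⟩ hsep
    by_contra! hS
    have hsmall : ∀ i k, f i = f k → dist (H i) (H k) ≤ 3 * β j := fun i k hik =>
      (hdiam i k hik).trans
        ((Finset.single_le_sum (fun a _ => hw a) (Finset.mem_univ (f i))).trans hS)
    by_cases hone : ∀ i k, f i = f k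
    · exact hfar fun i k => (hsmall i k (hone i k)).trans (hlast j hj)
    push Not at hone
    obtain ⟨p, q, hpq⟩ := hone
    refine hnone ⟨j, hj, _, isFinPartition_image_fibers f, ?_, ?_, ?_⟩
    · refine Finset.one_lt_card.2 ⟨_, Finset.mem_image_of_mem _ (Finset.mem_univ p), _,
        Finset.mem_image_of_mem _ (Finset.mem_univ q), fun h => hpq ?_⟩
      have : p ∈ Finset.univ.filter fun k => f k = f q := h ▸ by simp
      simpa using this
    · intro I hI i hi k hk
      obtain ⟨p, -, rfl⟩ := Finset.mem_image.1 hI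
      simp only [Finset.mem_filter, Finset.mem_univ, true_and] at hi hk
      exact hsmall i k (hi.trans hk.symm)
    · intro I hI J hJ hIJ i hi k hk
      obtain ⟨p, -, rfl⟩ := Finset.mem_image.1 hI
      obtain ⟨q, -, rfl⟩ := Finset.mem_image.1 hJ
      simp only [Finset.mem_filter, Finset.mem_univ, true_and] at hi hk
      refine hsep i k fun h => hIJ ?_
      rw [← hi, ← hk, h]
  have hinv : ∀ j, j ≤ r → ∃ f w, IsWeightedClustering H f w ∧
      (Finset.univ.image f).card + j ≤ r ∧
      ∑ a, w a ≤ 3 / 2 * (r - (Finset.univ.image f).card - j + 1 : ℝ) * β j := by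
    intro j
    induction j with
    | zero =>
      intro _
      refine ⟨id, fun _ => 0, ⟨fun _ => le_rfl, ?_⟩, by simp, by simp [hβ0]⟩
      intro i k hik
      rw [id, id] at hik
      simp [hik]
    | succ j ih =>
      intro hj
      obtain ⟨f, w, hfw, hcard, hsum⟩ := ih (by omega)
      obtain ⟨f', w', hfw', hsep, hcard', hsum'⟩ :=
        hfw.exists_separated (hnonneg (j + 1) hj)
      have hbig := hfail j hj f' w' hfw' hsep
      have hstep := hβ j hj
      have hb := hnonneg j (by omega)
      have hb' := hnonneg (j + 1) hj
      refine ⟨f', w', hfw', ?_⟩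
      generalize (Finset.univ.image f).card = n at *
      generalize (Finset.univ.image f').card = m at *
      have hx : (n : ℝ) + j ≤ r := by exact_mod_cast hcard
      have hS : ∑ a, w a ≤ (r - n - j + 1 : ℝ) / 2 * β (j + 1) := by
        nlinarith [mul_le_mul_of_nonneg_left hstep.le (by linarith : (0 : ℝ) ≤ r - n - j + 1)]
      push_cast
      rcases hcard'.eq_or_lt with rfl | hlt
      · have hlt : m + j + 1 < r := by
          by_contra! hle
          have hle' : (r : ℝ) ≤ m + j + 1 := by exact_mod_cast hle
          nlinarith [mul_le_mul_of_nonneg_right hle' hb]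
        have hlt' : (m : ℝ) + j + 1 ≤ r := by exact_mod_cast hlt.le
        refine ⟨by omega, ?_⟩
        nlinarith [mul_le_mul_of_nonneg_right hlt' hb']
      · have hlt' : (m : ℝ) + 1 ≤ n := by exact_mod_cast hlt
        refine ⟨by omega, ?_⟩
        nlinarith [mul_le_mul_of_nonneg_right hlt' hb', mul_le_mul_of_nonneg_right hx hb']
  obtain ⟨f, w, -, hcard, -⟩ := hinv r le_rfl
  have : 0 < (Finset.univ.image f).card :=
    Finset.card_pos.2 ⟨_, Finset.mem_image_of_mem f (Finset.mem_univ ⟨0, by omega⟩)⟩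
  omega
end

section
/- Let (T^ℓ)_{ℓ∈ℤ^d} be a measure-preserving ℤ^d-action on a probability space (E,μ) which is mixing of every order r′ with 2 ≤ r′ ≤ r, i.e., for all f_1,…,f_{r′} ∈ L^∞(μ), ∫ Π_{i=1}^{r′} f_i∘T^{ℓ_i} dμ → Π_{i=1}^{r′} ∫ f_i dμ as min_{i≠j} ‖ℓ_i − ℓ_j‖ → ∞. Then for every f ∈ L^∞(μ) with ∫ f dμ = 0, the joint cumulant satisfies C(f∘T^{ℓ_1}, …, f∘T^{ℓ_r}) → 0 as max_{i≠j} ‖ℓ_i − ℓ_j‖ → ∞. -/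
open MeasureTheory

open scoped Classical in
/-- The joint cumulant `C(Y₁,…,Y_r) = Σ_Q (-1)^{p-1} (p-1)! m(I₁)⋯m(I_p)`, the sum being
over all partitions `Q = {I₁,…,I_p}` of `{1,…,r}` into nonempty blocks, where
`m(I) = E(Π_{i∈I} Y_i)`. -/
noncomputable def jointCumulant {E : Type*} [MeasurableSpace E] (μ : Measure E)
    {r : ℕ} (Y : Fin r → E → ℝ) : ℝ :=
  ∑ Q ∈ Finset.univ.filter (fun Q : Finset (Finset (Fin r)) =>
      (∅ ∉ Q) ∧ (∀ I ∈ Q, ∀ J ∈ Q, I ≠ J → Disjoint I J) ∧ (Q.sup id = Finset.univ)),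
    (-1 : ℝ) ^ (Q.card - 1) * (Nat.factorial (Q.card - 1)) *
      ∏ I ∈ Q, ∫ x, ∏ i ∈ I, Y i x ∂μ

/-- The Euclidean norm of an element of `ℤ^d`. -/
noncomputable def znorm {d : ℕ} (v : Fin d → ℤ) : ℝ :=
  Real.sqrt (∑ i, ((v i : ℝ)) ^ 2)

/-! ### Set partitions and colourings -/

section Partitions

variable {ι : Type*} [Fintype ι] [DecidableEq ι]

/-- `Q` is a partition of the finite type `ι` into nonempty blocks. -/
def IsSetPartition (Q : Finset (Finset ι)) : Prop :=
  (∅ ∉ Q) ∧ (∀ I ∈ Q, ∀ J ∈ Q, I ≠ J → Disjoint I J) ∧ (Q.sup id = Finset.univ)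

/-- The set of nonempty fibres of a map. -/
def fiberSet {κ : Type*} [DecidableEq κ] (φ : ι → κ) : Finset (Finset ι) :=
  Finset.univ.image fun i => Finset.univ.filter fun j => φ j = φ i

lemma isSetPartition_fiberSet {κ : Type*} [DecidableEq κ] (φ : ι → κ) :
    IsSetPartition (fiberSet φ) := by
  refine ⟨?_, ?_, ?_⟩
  · simp only [fiberSet, Finset.mem_image, Finset.mem_univ, true_and, not_exists]
    intro i h
    have : i ∈ (Finset.univ.filter fun j => φ j = φ i) := by simp
    simp [h] at this
  · simp only [fiberSet, Finset.mem_image, Finset.mem_univ, true_and]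
    rintro _ ⟨i, rfl⟩ _ ⟨j, rfl⟩ hne
    rw [Finset.disjoint_left]
    intro k hk hk'
    simp only [Finset.mem_filter, Finset.mem_univ, true_and] at hk hk'
    exact hne (by rw [← hk, ← hk'])
  · ext i
    simp only [Finset.mem_sup, Finset.mem_univ, iff_true]
    exact ⟨Finset.univ.filter fun j => φ j = φ i, by simp [fiberSet], by simp⟩

lemma IsSetPartition.existsUnique_mem {Q : Finset (Finset ι)} (hQ : IsSetPartition Q) (i : ι) :
    ∃ I : Q, ∀ J : Q, i ∈ (J : Finset ι) ↔ I = J := by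
  have hi : i ∈ Q.sup id := by rw [hQ.2.2]; simp
  obtain ⟨I, hI, hiI⟩ := Finset.mem_sup.1 hi
  refine ⟨⟨I, hI⟩, fun J => ⟨fun hJ => ?_, ?_⟩⟩
  · by_contra hne
    exact Finset.disjoint_left.1
      (hQ.2.1 I hI J J.2 fun h => hne (Subtype.ext h)) hiI hJ
  · rintro rfl
    exact hiI

lemma card_filter_fiberSet_eq {Q : Finset (Finset ι)} (hQ : IsSetPartition Q) (N : ℕ) :
    (Finset.univ.filter fun φ : ι → Fin N => fiberSet φ = Q).card = N.descFactorial Q.card := by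
  choose β hβ using hQ.existsUnique_mem
  have hsurj : Function.Surjective β := by
    intro I
    have hne : (I : Finset ι).Nonempty := by
      rw [Finset.nonempty_iff_ne_empty]
      intro h
      exact hQ.1 (h ▸ I.2)
    obtain ⟨i, hi⟩ := hne
    exact ⟨i, (hβ i I).1 hi⟩
  have hblock : ∀ i, (β i : Finset ι) = Finset.univ.filter fun k => β k = β i := by
    intro i
    ext k
    simp [hβ]
  have hcard : N.descFactorial Q.card = (Finset.univ : Finset (Q ↪ Fin N)).card := by
    rw [Finset.card_univ, Fintype.card_embedding_eq]
    simp
  rw [hcard]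
  symm
  refine Finset.card_bij (fun e _ => e ∘ β) ?_ ?_ ?_
  · intro e _
    simp only [Finset.mem_filter, Finset.mem_univ, true_and]
    ext I
    simp only [fiberSet, Finset.mem_image, Finset.mem_univ, true_and, Function.comp_apply,
      EmbeddingLike.apply_eq_iff_eq, ← hblock]
    constructor
    · rintro ⟨i, rfl⟩
      exact (β i).2
    · intro hI
      obtain ⟨i, hi⟩ := hsurj ⟨I, hI⟩
      exact ⟨i, by rw [hi]⟩
  · intro e _ e' _ h
    ext1 I
    obtain ⟨i, rfl⟩ := hsurj I
    exact congrFun h i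
  · intro φ hφ
    simp only [Finset.mem_filter, Finset.mem_univ, true_and] at hφ
    have hker : ∀ i k, φ k = φ i ↔ β k = β i := by
      intro i k
      have hmem : (β i : Finset ι) ∈ fiberSet φ := hφ ▸ (β i).2
      obtain ⟨j, -, hj⟩ := Finset.mem_image.1 hmem
      have hi : i ∈ (β i : Finset ι) := (hβ i _).2 rfl
      rw [← hβ k (β i), ← hj]
      rw [← hj] at hi
      simp only [Finset.mem_filter, Finset.mem_univ, true_and] at hi ⊢
      rw [hi]
    refine ⟨⟨fun I => φ (Function.surjInv hsurj I), fun I J h => ?_⟩, Finset.mem_univ _, ?_⟩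
    · have := (hker _ _).1 h
      rwa [Function.surjInv_eq hsurj, Function.surjInv_eq hsurj] at this
    · funext i
      exact (hker _ _).2 (Function.surjInv_eq hsurj (β i))

lemma prod_fiber_eq_prod_fiberSet {κ : Type*} [Fintype κ] [DecidableEq κ] (m : Finset ι → ℝ)
    (hm : m ∅ = 1) (φ : ι → κ) :
    ∏ c, m (Finset.univ.filter fun i => φ i = c) = ∏ I ∈ fiberSet φ, m I := by
  have himage : fiberSet φ =
      (Finset.univ.image φ).image fun c => Finset.univ.filter fun i => φ i = c := by
    rw [Finset.image_image]
    rfl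
  rw [himage, Finset.prod_image]
  · symm
    refine Finset.prod_subset (Finset.subset_univ _) fun c _ hc => ?_
    rw [Finset.filter_eq_empty_iff.2, hm]
    intro i _ h
    exact hc (Finset.mem_image.2 ⟨i, Finset.mem_univ _, h⟩)
  · intro c hc c' _ h
    obtain ⟨i, -, rfl⟩ := Finset.mem_image.1 hc
    have hi : i ∈ Finset.univ.filter fun j => φ j = φ i := by simp
    have hi' : i ∈ Finset.univ.filter fun j => φ j = c' := by
      have h' : (Finset.univ.filter fun j => φ j = φ i) =
        Finset.univ.filter fun j => φ j = c' := h
      rwa [← h']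
    simpa using hi'

open scoped Classical in
/-- The polynomial interpolating `N ↦ ∑_{φ : ι → Fin N} ∏_c m(φ⁻¹(c))`. -/
noncomputable def colouringPolynomial (m : Finset ι → ℝ) : Polynomial ℝ :=
  ∑ Q ∈ Finset.univ.filter (fun Q : Finset (Finset ι) => IsSetPartition Q),
    Polynomial.C (∏ I ∈ Q, m I) * descPochhammer ℝ Q.card

lemma eval_natCast_colouringPolynomial (m : Finset ι → ℝ) (hm : m ∅ = 1) (N : ℕ) :
    (colouringPolynomial m).eval (N : ℝ) =
      ∑ φ : ι → Fin N, ∏ c, m (Finset.univ.filter fun i => φ i = c) := by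
  classical
  simp_rw [prod_fiber_eq_prod_fiberSet m hm]
  rw [← Finset.sum_fiberwise_of_maps_to (g := fiberSet)
    (t := Finset.univ.filter fun Q : Finset (Finset ι) => IsSetPartition Q)
    (fun φ _ => by simpa using isSetPartition_fiberSet φ)]
  rw [colouringPolynomial, Polynomial.eval_finsetSum]
  refine Finset.sum_congr (by congr) fun Q hQ => ?_
  have hQ' : IsSetPartition Q := (Finset.mem_filter.1 hQ).2
  rw [Finset.sum_congr rfl (g := fun _ => ∏ I ∈ Q, m I)
    (fun φ hφ => by rw [(Finset.mem_filter.1 hφ).2]), Finset.sum_const,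
    card_filter_fiberSet_eq hQ', Polynomial.eval_mul, Polynomial.eval_C,
    descPochhammer_eval_eq_descFactorial, nsmul_eq_mul, mul_comm]

lemma eval_zero_colouringPolynomial [Nonempty ι] (m : Finset ι → ℝ) (hm : m ∅ = 1) :
    (colouringPolynomial m).eval 0 = 0 := by
  have h := eval_natCast_colouringPolynomial m hm 0
  rw [Nat.cast_zero] at h
  rw [h]
  exact Fintype.sum_empty _

lemma descPochhammer_eval_neg_one (n : ℕ) :
    (descPochhammer ℝ n).eval (-1) = (-1) ^ n * (n.factorial : ℝ) := by
  induction n with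
  | zero => simp
  | succ n ih =>
    rw [descPochhammer_succ_eval, ih, Nat.factorial_succ]
    push_cast
    ring

lemma derivative_descPochhammer_eval_zero {n : ℕ} (hn : n ≠ 0) :
    (Polynomial.derivative (descPochhammer ℝ n)).eval 0 =
      (-1) ^ (n - 1) * ((n - 1).factorial : ℝ) := by
  obtain ⟨k, rfl⟩ := Nat.exists_eq_succ_of_ne_zero hn
  simp [descPochhammer_succ_left, Polynomial.derivative_mul, Polynomial.eval_comp,
    descPochhammer_eval_neg_one]

open scoped Classical in
lemma derivative_colouringPolynomial_eval_zero [Nonempty ι] (m : Finset ι → ℝ) :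
    (Polynomial.derivative (colouringPolynomial m)).eval 0 =
      ∑ Q ∈ Finset.univ.filter (fun Q : Finset (Finset ι) => IsSetPartition Q),
        (-1 : ℝ) ^ (Q.card - 1) * (Nat.factorial (Q.card - 1)) * ∏ I ∈ Q, m I := by
  rw [colouringPolynomial, Polynomial.derivative_sum, Polynomial.eval_finsetSum]
  refine Finset.sum_congr rfl fun Q hQ => ?_
  have hcard : Q.card ≠ 0 := by
    rw [Finset.card_ne_zero, Finset.nonempty_iff_ne_empty]
    rintro rfl
    have h := (Finset.mem_filter.1 hQ).2.2.2
    rw [Finset.sup_empty] at h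
    exact Finset.univ_nonempty.ne_empty h.symm
  rw [Polynomial.derivative_C_mul, Polynomial.eval_mul, Polynomial.eval_C,
    derivative_descPochhammer_eval_zero hcard, mul_comm]

/-- If `m` factorises along `p`, so does its colouring polynomial. -/
lemma colouringPolynomial_eq_mul (m : Finset ι → ℝ) (hm : m ∅ = 1) (p : ι → Prop)
    [DecidablePred p] (hmul : ∀ I, m I = m (I.filter p) * m (I.filter fun i => ¬ p i)) :
    colouringPolynomial m =
      colouringPolynomial (fun I : Finset {i // p i} => m (I.map (Function.Embedding.subtype _))) *
      colouringPolynomial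
        (fun I : Finset {i // ¬ p i} => m (I.map (Function.Embedding.subtype _))) := by
  refine Polynomial.eq_of_infinite_eval_eq _ _ ?_
  refine (Set.infinite_range_of_injective (Nat.cast_injective (R := ℝ))).mono ?_
  rintro _ ⟨N, rfl⟩
  rw [Set.mem_ofPred_eq, Polynomial.eval_mul, eval_natCast_colouringPolynomial _ hm,
    eval_natCast_colouringPolynomial _ (by simpa using hm),
    eval_natCast_colouringPolynomial _ (by simpa using hm), Finset.sum_mul_sum,
    ← Fintype.sum_prod_type', ← (Equiv.piEquivPiSubtypeProd p fun _ => Fin N).sum_comp]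
  refine Finset.sum_congr rfl fun φ _ => ?_
  rw [← Finset.prod_mul_distrib]
  refine Finset.prod_congr rfl fun c _ => ?_
  rw [hmul]
  congr 2
  · ext i
    simp [and_comm]
  · ext i
    simp [and_comm]

open scoped Classical in
/-- The cumulant of a moment function that factorises along a nontrivial splitting vanishes. -/
lemma sum_isSetPartition_eq_zero (m : Finset ι → ℝ) (hm : m ∅ = 1) (p : ι → Prop)
    (hmul : ∀ I, m I = m (I.filter p) * m (I.filter fun i => ¬ p i))
    (hp : ∃ i, p i) (hp' : ∃ i, ¬ p i) :
    ∑ Q ∈ Finset.univ.filter (fun Q : Finset (Finset ι) => IsSetPartition Q),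
      (-1 : ℝ) ^ (Q.card - 1) * (Nat.factorial (Q.card - 1)) * ∏ I ∈ Q, m I = 0 := by
  have : Nonempty {i // p i} := let ⟨i, hi⟩ := hp; ⟨⟨i, hi⟩⟩
  have : Nonempty {i // ¬ p i} := let ⟨i, hi⟩ := hp'; ⟨⟨i, hi⟩⟩
  have : Nonempty ι := let ⟨i, _⟩ := hp; ⟨i⟩
  rw [← derivative_colouringPolynomial_eval_zero, colouringPolynomial_eq_mul m hm p hmul,
    Polynomial.derivative_mul, Polynomial.eval_add, Polynomial.eval_mul, Polynomial.eval_mul,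
    eval_zero_colouringPolynomial _ (by simpa using hm),
    eval_zero_colouringPolynomial _ (by simpa using hm)]
  simp

end Partitions

open scoped Classical in
lemma jointCumulant_eq {E : Type*} [MeasurableSpace E] (μ : Measure E) {r : ℕ}
    (Y : Fin r → E → ℝ) :
    jointCumulant μ Y =
      ∑ Q ∈ Finset.univ.filter (fun Q : Finset (Finset (Fin r)) => IsSetPartition Q),
        (-1 : ℝ) ^ (Q.card - 1) * (Nat.factorial (Q.card - 1)) *
          ∏ I ∈ Q, ∫ x, ∏ i ∈ I, Y i x ∂μ := by
  unfold jointCumulant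
  refine Finset.sum_congr ?_ fun _ _ => rfl
  ext Q
  rw [Finset.mem_filter, Finset.mem_filter]
  rfl

/-! ### Norms on `ℤ^d` along ultrafilters -/

lemma finite_setOf_znorm_lt {d : ℕ} (M : ℝ) : {v : Fin d → ℤ | znorm v < M}.Finite := by
  refine (Set.finite_Icc (fun _ : Fin d => -⌈M⌉) (fun _ => ⌈M⌉)).subset fun v hv => ?_
  have habs : ∀ i, |(v i : ℝ)| ≤ (⌈M⌉ : ℤ) := fun i => by
    have h : |(v i : ℝ)| ≤ znorm v := by
      refine Real.abs_le_sqrt ?_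
      exact Finset.single_le_sum (f := fun i => (v i : ℝ) ^ 2) (fun i _ => sq_nonneg _)
        (Finset.mem_univ i)
    exact (h.trans (le_of_lt hv)).trans (Int.le_ceil M)
  constructor <;> intro i
  · have := (abs_le.1 (habs i)).1
    exact_mod_cast this
  · have := (abs_le.1 (habs i)).2
    exact_mod_cast this

/-- Along an ultrafilter, a `ℤ^d`-valued map is either eventually constant or escapes to
infinity. -/
lemma eventually_le_znorm {α : Type*} {d : ℕ} (U : Ultrafilter α) (u : α → Fin d → ℤ)
    (hu : ¬ ∃ v, ∀ᶠ a in U, u a = v) (M : ℝ) : ∀ᶠ a in U, M ≤ znorm (u a) := by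
  by_contra h
  rw [← Ultrafilter.eventually_not] at h
  have h' : ∀ᶠ a in U, ∃ v ∈ {v : Fin d → ℤ | znorm v < M}, u a = v :=
    h.mono fun a ha => ⟨u a, not_le.1 ha, rfl⟩
  rw [Ultrafilter.eventually_exists_mem_iff (finite_setOf_znorm_lt M)] at h'
  obtain ⟨v, -, hv⟩ := h'
  exact hu ⟨v, hv⟩

/-! ### Limits of moments and cumulants -/

section Mixing

open Filter Topology

variable {d : ℕ} {E : Type*} [MeasurableSpace E] {μ : Measure E} {T : (Fin d → ℤ) → E → E}

/-- Mixing of order `r'`, for families indexed by an arbitrary finite type, along a filter. -/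
lemma tendsto_integral_prod_of_mixing {r' : ℕ}
    (hmix : ∀ f : Fin r' → E → ℝ,
      (∀ i, Measurable (f i)) → (∀ i, ∃ C : ℝ, ∀ x, |f i x| ≤ C) →
      ∀ ε : ℝ, 0 < ε → ∃ M : ℝ, ∀ ℓ : Fin r' → (Fin d → ℤ),
        (∀ i j, i ≠ j → M ≤ znorm (ℓ i - ℓ j)) →
        |(∫ x, ∏ i, f i (T (ℓ i) x) ∂μ) - ∏ i, ∫ x, f i x ∂μ| ≤ ε)
    {κ : Type*} [Fintype κ] (e : Fin r' ≃ κ) (F : κ → E → ℝ) (hF : ∀ k, Measurable (F k))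
    (hFb : ∀ k, ∃ C : ℝ, ∀ x, |F k x| ≤ C) {α : Type*} {l : Filter α}
    (ρ : α → κ → Fin d → ℤ)
    (hρ : ∀ j k, j ≠ k → ∀ M : ℝ, ∀ᶠ a in l, M ≤ znorm (ρ a j - ρ a k)) :
    Tendsto (fun a => ∫ x, ∏ k, F k (T (ρ a k) x) ∂μ) l (𝓝 (∏ k, ∫ x, F k x ∂μ)) := by
  rw [Metric.tendsto_nhds]
  intro ε hε
  obtain ⟨M, hM⟩ := hmix (fun i => F (e i)) (fun i => hF _) (fun i => hFb _) (ε / 2) (half_pos hε)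
  have hev : ∀ᶠ a in l, ∀ i j, i ≠ j → M ≤ znorm (ρ a (e i) - ρ a (e j)) := by
    rw [eventually_all]
    intro i
    rw [eventually_all]
    intro j
    by_cases hij : i = j
    · simp [hij]
    · filter_upwards [hρ _ _ (e.injective.ne hij) M] with a ha _ using ha
  filter_upwards [hev] with a ha
  have h := hM (fun i => ρ a (e i)) ha
  rw [e.prod_comp fun k => ∫ x, F k x ∂μ] at h
  have hint : ∀ x, ∏ i, F (e i) (T (ρ a (e i)) x) = ∏ k, F k (T (ρ a k) x) := fun x =>
    e.prod_comp fun k => F k (T (ρ a k) x)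
  simp_rw [hint] at h
  rw [Real.dist_eq]
  linarith

/-- Along an ultrafilter on which the index differences are not all bounded, the joint cumulant
of the translates of a bounded function under a mixing action tends to zero. -/
lemma tendsto_jointCumulant_of_mixing (hT : ∀ ℓ, Measurable (T ℓ))
    (hTadd : ∀ ℓ ℓ', T (ℓ + ℓ') = T ℓ ∘ T ℓ') [IsProbabilityMeasure μ] {r : ℕ}
    (hmix : ∀ r' : ℕ, 2 ≤ r' → r' ≤ r → ∀ f : Fin r' → E → ℝ,
      (∀ i, Measurable (f i)) → (∀ i, ∃ C : ℝ, ∀ x, |f i x| ≤ C) →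
      ∀ ε : ℝ, 0 < ε → ∃ M : ℝ, ∀ ℓ : Fin r' → (Fin d → ℤ),
        (∀ i j, i ≠ j → M ≤ znorm (ℓ i - ℓ j)) →
        |(∫ x, ∏ i, f i (T (ℓ i) x) ∂μ) - ∏ i, ∫ x, f i x ∂μ| ≤ ε)
    {f : E → ℝ} (hf : Measurable f) (hfb : ∃ C : ℝ, ∀ x, |f x| ≤ C)
    (U : Ultrafilter (Fin r → Fin d → ℤ)) {i₀ j₀ : Fin r}
    (hU : ¬ ∃ v, ∀ᶠ ℓ : Fin r → Fin d → ℤ in U, ℓ i₀ - ℓ j₀ = v) :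
    Tendsto (fun (ℓ : Fin r → Fin d → ℤ) => jointCumulant μ fun i x => f (T (ℓ i) x)) U (𝓝 0) := by
  classical
  let s : Setoid (Fin r) :=
    { r := fun i j => ∃ v, ∀ᶠ ℓ : Fin r → Fin d → ℤ in U, ℓ i - ℓ j = v
      iseqv :=
        { refl := fun i => ⟨0, by simp⟩
          symm := fun ⟨v, hv⟩ => ⟨-v, hv.mono fun ℓ h => by rw [← h, neg_sub]⟩
          trans := fun ⟨v, hv⟩ ⟨w, hw⟩ =>
            ⟨v + w, (hv.and hw).mono fun ℓ h => by rw [← h.1, ← h.2, sub_add_sub_cancel]⟩ } }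
  let π : Fin r → Quotient s := fun i => Quotient.mk s i
  have hne : π i₀ ≠ π j₀ := fun h => hU (Quotient.exact h)
  have hcard : 2 ≤ Fintype.card (Quotient s) :=
    Fintype.one_lt_card_iff.2 ⟨_, _, hne⟩
  have hcard' : Fintype.card (Quotient s) ≤ r := by
    simpa using Fintype.card_quotient_le s
  have hshift : ∀ i, ∃ v, ∀ᶠ ℓ : Fin r → Fin d → ℤ in U, ℓ i - ℓ (π i).out = v := fun i =>
    Quotient.exact (Quotient.out_eq (π i)).symm
  choose v hv using hshift
  let g : Finset (Fin r) → ℝ := fun I => ∫ x, ∏ i ∈ I, f (T (v i) x) ∂μ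
  let m : Finset (Fin r) → ℝ := fun I => ∏ c, g (I.filter fun i => π i = c)
  have hg : g ∅ = 1 := by simp [g]
  have hm : m ∅ = 1 := by simp [m, hg]
  have hmoment : ∀ I : Finset (Fin r),
      Tendsto (fun ℓ : Fin r → Fin d → ℤ => ∫ x, ∏ i ∈ I, f (T (ℓ i) x) ∂μ) U (𝓝 (m I)) := by
    intro I
    have hlim := tendsto_integral_prod_of_mixing (hmix _ hcard hcard')
      (Fintype.equivFin (Quotient s)).symm
      (fun c x => ∏ i ∈ I.filter (fun i => π i = c), f (T (v i) x))
      (fun c => Finset.measurable_prod _ fun i _ => hf.comp (hT _)) ?_ (l := (U : Filter _))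
      (fun (ℓ : Fin r → Fin d → ℤ) c => ℓ c.out) ?_
    · refine hlim.congr' ?_
      filter_upwards [eventually_all.2 hv] with ℓ hℓ
      congr 1 with x
      rw [← Finset.prod_fiberwise I π]
      refine Finset.prod_congr rfl fun c _ => Finset.prod_congr rfl fun i hi => ?_
      have hic : π i = c := (Finset.mem_filter.1 hi).2
      have hadd : ℓ i = v i + ℓ c.out := by rw [← hℓ i, hic, sub_add_cancel]
      rw [hadd, hTadd]
      rfl
    · intro c
      obtain ⟨C, hC⟩ := hfb
      refine ⟨∏ i ∈ I.filter (fun i => π i = c), C, fun x => ?_⟩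
      rw [Finset.abs_prod]
      exact Finset.prod_le_prod (fun _ _ => abs_nonneg _) fun _ _ => hC _
    · intro c c' hcc' M
      refine eventually_le_znorm U (fun ℓ => ℓ c.out - ℓ c'.out) (fun h => hcc' ?_) M
      rw [← Quotient.out_eq c, ← Quotient.out_eq c']
      exact Quotient.sound h
  have hmul : ∀ I, m I =
      m (I.filter fun i => π i = π i₀) * m (I.filter fun i => ¬ π i = π i₀) := by
    intro I
    simp only [m]
    rw [← Finset.prod_mul_distrib]
    refine Finset.prod_congr rfl fun c _ => ?_
    simp only [Finset.filter_filter]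
    by_cases hc : c = π i₀
    · subst hc
      have h1 : (I.filter fun i => π i = π i₀ ∧ π i = π i₀) = I.filter fun i => π i = π i₀ := by
        simp
      have h2 : (I.filter fun i => ¬ π i = π i₀ ∧ π i = π i₀) = ∅ := by simp
      rw [h1, h2, hg, mul_one]
    · have h1 : (I.filter fun i => π i = π i₀ ∧ π i = c) = ∅ := by
        refine Finset.filter_eq_empty_iff.2 fun i _ h => hc (h.2.symm.trans h.1)
      have h2 : (I.filter fun i => ¬ π i = π i₀ ∧ π i = c) = I.filter fun i => π i = c := by
        refine Finset.filter_congr fun i _ => ⟨fun h => h.2, fun h => ⟨fun h' => ?_, h⟩⟩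
        exact hc (h.symm.trans h')
      rw [h1, h2, hg, one_mul]
  have hzero := sum_isSetPartition_eq_zero m hm (fun i => π i = π i₀)
    (fun I => by convert hmul I) ⟨i₀, rfl⟩ ⟨j₀, hne.symm⟩
  rw [← hzero]
  simp only [jointCumulant_eq]
  exact tendsto_finsetSum _ fun Q _ =>
    (tendsto_finsetProd _ fun I _ => hmoment I).const_mul _

end Mixing

/-- If a measure-preserving `ℤ^d`-action is mixing of every order
`2 ≤ r' ≤ r`, then for every bounded centered observable `f`, the joint cumulant
`C(f∘T^{ℓ₁},…,f∘T^{ℓ_r})` tends to `0` as `max_{i≠j} ‖ℓ_i - ℓ_j‖ → ∞`. -/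
theorem quenched_fclt_stmt12 {d : ℕ} {E : Type*} [MeasurableSpace E]
    (μ : Measure E) [IsProbabilityMeasure μ]
    (T : (Fin d → ℤ) → E → E)
    (hT : ∀ ℓ, MeasurePreserving (T ℓ) μ μ)
    (hT0 : T 0 = id)
    (hTadd : ∀ ℓ ℓ', T (ℓ + ℓ') = T ℓ ∘ T ℓ')
    (r : ℕ) (hr : 2 ≤ r)
    -- mixing of every order r' with 2 ≤ r' ≤ r
    (hmix : ∀ r' : ℕ, 2 ≤ r' → r' ≤ r → ∀ f : Fin r' → E → ℝ,
      (∀ i, Measurable (f i)) → (∀ i, ∃ C : ℝ, ∀ x, |f i x| ≤ C) →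
      ∀ ε : ℝ, 0 < ε → ∃ M : ℝ, ∀ ℓ : Fin r' → (Fin d → ℤ),
        (∀ i j, i ≠ j → M ≤ znorm (ℓ i - ℓ j)) →
        |(∫ x, ∏ i, f i (T (ℓ i) x) ∂μ) - ∏ i, ∫ x, f i x ∂μ| ≤ ε) :
    ∀ f : E → ℝ, Measurable f → (∃ C : ℝ, ∀ x, |f x| ≤ C) → (∫ x, f x ∂μ) = 0 →
      ∀ ε : ℝ, 0 < ε → ∃ M : ℝ, ∀ ℓ : Fin r → (Fin d → ℤ),
        (∃ i j, i ≠ j ∧ M ≤ znorm (ℓ i - ℓ j)) →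
        |jointCumulant μ (fun i x => f (T (ℓ i) x))| ≤ ε := by
  intro f hf hfb _ ε hε
  let G : (Fin r → Fin d → ℤ) → ℝ := fun ℓ => ∑ i, ∑ j, znorm (ℓ i - ℓ j)
  have hG : ∀ ℓ i j, znorm (ℓ i - ℓ j) ≤ G ℓ := fun ℓ i j =>
    (Finset.single_le_sum (f := fun j => znorm (ℓ i - ℓ j)) (fun _ _ => Real.sqrt_nonneg _)
      (Finset.mem_univ j)).trans
      (Finset.single_le_sum (f := fun i => ∑ j, znorm (ℓ i - ℓ j))
        (fun _ _ => Finset.sum_nonneg fun _ _ => Real.sqrt_nonneg _) (Finset.mem_univ i))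
  have hlim : Filter.Tendsto (fun ℓ => jointCumulant μ fun i x => f (T (ℓ i) x))
      (Filter.comap G Filter.atTop) (nhds 0) := by
    rw [Filter.tendsto_iff_ultrafilter]
    intro U hU
    have hGU : Filter.Tendsto G U Filter.atTop := Filter.tendsto_iff_comap.2 hU
    obtain ⟨i₀, j₀, h⟩ : ∃ i j, ¬ ∃ v, ∀ᶠ ℓ : Fin r → Fin d → ℤ in U, ℓ i - ℓ j = v := by
      by_contra! hcon
      choose v hv using hcon
      have hconst : ∀ᶠ ℓ in U, G ℓ = ∑ i, ∑ j, znorm (v i j) := by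
        filter_upwards [Filter.eventually_all.2 fun i => Filter.eventually_all.2 (hv i)] with ℓ hℓ
        simp only [G, hℓ]
      obtain ⟨ℓ, h₁, h₂⟩ := (hconst.and (hGU.eventually_gt_atTop _)).exists
      exact h₂.ne' h₁
    exact tendsto_jointCumulant_of_mixing (fun ℓ => (hT ℓ).measurable) hTadd hmix hf hfb U h
  have hev := hlim.eventually (Metric.closedBall_mem_nhds (0 : ℝ) hε)
  rw [(Filter.atTop_basis.comap G).eventually_iff] at hev
  obtain ⟨M, -, hM⟩ := hev
  refine ⟨M, fun ℓ ⟨i, j, _, hij⟩ => ?_⟩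
  simpa using hM (show ℓ ∈ G ⁻¹' Set.Ici M from hij.trans (hG ℓ i j))
end

section
/- Let (T^ℓ)_{ℓ∈ℤ^d} be a measure-preserving ℤ^d-action on a probability space (E,μ) and let f ∈ L^∞(μ) be real with ∫ f dμ = 0 and Σ_{ℓ∈ℤ^d} |⟨f∘T^ℓ, f⟩| < ∞, with spectral density φ_f. Let (w_n)_{n≥1} be a summation sequence on ℤ^d which is ξ-regular for a probability measure ξ on 𝕋^d. If for every r ≥ 3 one has Σ_{(ℓ_1,…,ℓ_r) ∈ (ℤ^d)^r} w_n(ℓ_1)⋯w_n(ℓ_r) · C(f∘T^{ℓ_1}, …, f∘T^{ℓ_r}) = o( (Σ_{ℓ} w_n(ℓ)²)^{r/2} ) as n → ∞, then (Σ_ℓ w_n(ℓ)²)^{−1/2} · Σ_{ℓ∈ℤ^d} w_n(ℓ) f∘T^ℓ converges in distribution under μ to the Gaussian law N(0, ξ(φ_f)). -/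
open MeasureTheory ProbabilityTheory Filter Topology

/-- The character `t ↦ e^{2πi⟨ℓ,t⟩}` of the torus `𝕋^d = (ℝ/ℤ)^d`. -/
noncomputable def torusChar {d : ℕ} (ℓ : Fin d → ℤ) (t : Fin d → AddCircle (1 : ℝ)) : ℂ :=
  (AddCircle.toCircle (∑ j, ℓ j • t j) : ℂ)

/-- The normalized kernel `K̃(w)(t) = |Σ_ℓ w(ℓ) e^{2πi⟨ℓ,t⟩}|² / Σ_ℓ w(ℓ)²`. -/
noncomputable def normKernel {d : ℕ} (w : (Fin d → ℤ) → ℝ)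
    (t : Fin d → AddCircle (1 : ℝ)) : ℝ :=
  ‖∑' ℓ : Fin d → ℤ, (w ℓ : ℂ) * torusChar ℓ t‖ ^ 2 / ∑' ℓ : Fin d → ℤ, (w ℓ) ^ 2

/-- The spectral density `φ(t) = Σ_ℓ a_ℓ e^{2πi⟨ℓ,t⟩}` (a real-valued function when the
correlation coefficients `a` are even, as is the case for correlations of an action). -/
noncomputable def specDensity {d : ℕ} (a : (Fin d → ℤ) → ℝ)
    (t : Fin d → AddCircle (1 : ℝ)) : ℝ :=
  (∑' ℓ : Fin d → ℤ, (a ℓ : ℂ) * torusChar ℓ t).re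

/-- The product of the sums of finitely many absolutely convergent series. -/
lemma summable_and_tsum_pi_prod {ι : Type*} {r : ℕ} (g : Fin r → ι → ℝ)
    (hg : ∀ i, Summable fun ℓ => ‖g i ℓ‖) :
    (Summable fun L : Fin r → ι => ‖∏ i, g i (L i)‖) ∧
      ∑' L : Fin r → ι, ∏ i, g i (L i) = ∏ i, ∑' ℓ, g i ℓ := by
  induction r with
  | zero => exact ⟨Summable.of_finite, by simp⟩
  | succ r ih =>
    obtain ⟨b, hb⟩ : ∃ b : (Fin r → ι) → ℝ, b = fun L => ∏ i, g i.succ (L i) := ⟨_, rfl⟩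
    obtain ⟨hs, ht⟩ := ih (fun i => g i.succ) (fun i => hg i.succ)
    have hs' : Summable fun L => ‖b L‖ := by rw [hb]; exact hs
    have ht' : ∑' L, b L = ∏ i : Fin r, ∑' ℓ, g i.succ ℓ := by rw [hb]; exact ht
    have key (p : ι × (Fin r → ι)) :
        ∏ i, g i ((Fin.consEquiv fun _ => ι) p i) = g 0 p.1 * b p.2 := by
      simp [hb, Fin.prod_univ_succ, Fin.consEquiv]
    rw [← (Fin.consEquiv fun _ => ι).summable_iff, ← (Fin.consEquiv fun _ => ι).tsum_eq,
      Fin.prod_univ_succ, ← ht', tsum_mul_tsum_of_summable_norm (hg 0) hs']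
    simp only [Function.comp_def, key, and_true]
    exact Summable.mul_norm (hg 0) hs'

lemma norm_exp_I_sub_sum_le_of_nonneg (n : ℕ) {x : ℝ} (hx : 0 ≤ x) :
    ‖Complex.exp (x * Complex.I) - ∑ k ∈ Finset.range n, (x * Complex.I) ^ k / (k.factorial : ℂ)‖
      ≤ x ^ n / n.factorial := by
  induction n generalizing x with
  | zero => simp [Complex.norm_exp_ofReal_mul_I]
  | succ n ih =>
    let F : ℝ → ℂ := fun x => Complex.exp (x * Complex.I) -
      ∑ k ∈ Finset.range (n + 1), (x * Complex.I) ^ k / (k.factorial : ℂ)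
    have hF : ∀ y : ℝ, HasDerivAt F (Complex.I * (Complex.exp (y * Complex.I) -
        ∑ k ∈ Finset.range n, (y * Complex.I) ^ k / (k.factorial : ℂ))) y := by
      intro y
      have h1 : HasDerivAt (fun y : ℝ => (y : ℂ) * Complex.I) Complex.I y := by
        simpa using (Complex.ofRealCLM.hasDerivAt (x := y)).mul_const Complex.I
      have h2 := h1.cexp
      have h3 : HasDerivAt (fun y : ℝ =>
          ∑ k ∈ Finset.range (n + 1), ((y : ℂ) * Complex.I) ^ k / (k.factorial : ℂ))
          (∑ k ∈ Finset.range n, Complex.I * ((y * Complex.I) ^ k / (k.factorial : ℂ))) y := by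
        have : (fun y : ℝ => ∑ k ∈ Finset.range (n + 1),
            ((y : ℂ) * Complex.I) ^ k / (k.factorial : ℂ)) = fun y : ℝ =>
            ∑ k ∈ Finset.range n, ((y : ℂ) * Complex.I) ^ (k + 1) / ((k + 1).factorial : ℂ) + 1 := by
          ext y
          simp [Finset.sum_range_succ']
        rw [this]
        refine (HasDerivAt.fun_sum fun k _ => ?_).add_const _
        have h4 := (h1.pow (k + 1)).div_const ((k + 1).factorial : ℂ)
        refine h4.congr_deriv ?_
        have : (k.factorial : ℂ) ≠ 0 := by exact_mod_cast k.factorial_ne_zero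
        have : (k + 1 : ℂ) ≠ 0 := by exact_mod_cast k.succ_ne_zero
        push_cast [Nat.factorial_succ]
        field_simp
      refine (h2.sub h3).congr_deriv ?_
      rw [mul_sub, Finset.mul_sum]
      ring
    have hB : ∀ y : ℝ, HasDerivAt (fun y : ℝ => y ^ (n + 1) / ((n + 1).factorial : ℝ))
        (y ^ n / (n.factorial : ℝ)) y := by
      intro y
      refine ((hasDerivAt_pow (n + 1) y).div_const ((n + 1).factorial : ℝ)).congr_deriv ?_
      have : (n.factorial : ℝ) ≠ 0 := by exact_mod_cast n.factorial_ne_zero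
      push_cast [Nat.factorial_succ]
      have : (n + 1 : ℝ) ≠ 0 := by positivity
      field_simp
    refine image_norm_le_of_norm_deriv_right_le_deriv_boundary (a := 0) (b := x) (f := F)
      (fun y _ => (hF y).continuousAt.continuousWithinAt) (fun y _ => (hF y).hasDerivWithinAt)
      (B := fun y : ℝ => y ^ (n + 1) / ((n + 1).factorial : ℝ)) ?_ hB ?_
      (Set.right_mem_Icc.2 hx)
    · simp [F, Finset.sum_range_succ']
    · intro y hy
      simpa using ih hy.1

lemma norm_exp_I_sub_sum_le (n : ℕ) (x : ℝ) :
    ‖Complex.exp (x * Complex.I) - ∑ k ∈ Finset.range n, (x * Complex.I) ^ k / (k.factorial : ℂ)‖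
      ≤ |x| ^ n / n.factorial := by
  rcases le_total 0 x with hx | hx
  · simpa [abs_of_nonneg hx] using norm_exp_I_sub_sum_le_of_nonneg n hx
  · rw [abs_of_nonpos hx]
    refine le_trans (le_of_eq ?_) (norm_exp_I_sub_sum_le_of_nonneg n (neg_nonneg.2 hx))
    rw [← Complex.norm_conj]
    congr 1
    simp [← Complex.exp_conj]

/-- The characteristic function of a measure is approximated by its moments. -/
lemma norm_charFun_sub_sum_moments_le (ν : Measure ℝ) [IsFiniteMeasure ν]
    (hν : ∀ k : ℕ, Integrable (fun x => x ^ k) ν) (t : ℝ) (m : ℕ) :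
    ‖charFun ν t - ∑ k ∈ Finset.range (2 * m),
        (t * Complex.I) ^ k / (k.factorial : ℂ) * ((∫ x, x ^ k ∂ν : ℝ) : ℂ)‖
      ≤ t ^ (2 * m) / (2 * m).factorial * ∫ x, x ^ (2 * m) ∂ν := by
  have hk : ∀ k : ℕ, Integrable (fun x : ℝ =>
      (t * Complex.I) ^ k / (k.factorial : ℂ) * ((x ^ k : ℝ) : ℂ)) ν :=
    fun k => (hν k).ofReal.const_mul _
  have he : Integrable (fun x : ℝ => Complex.exp (t * x * Complex.I)) ν := by
    refine Integrable.of_bound (by fun_prop) 1 (.of_forall fun x => ?_)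
    exact_mod_cast (Complex.norm_exp_ofReal_mul_I (t * x)).le
  rw [charFun_apply_real]
  have : ∑ k ∈ Finset.range (2 * m),
      (t * Complex.I) ^ k / (k.factorial : ℂ) * ((∫ x, x ^ k ∂ν : ℝ) : ℂ) =
      ∫ x, ∑ k ∈ Finset.range (2 * m),
        (t * Complex.I) ^ k / (k.factorial : ℂ) * ((x ^ k : ℝ) : ℂ) ∂ν := by
    rw [integral_finsetSum _ fun k _ => hk k]
    refine Finset.sum_congr rfl fun k _ => ?_
    rw [integral_const_mul, integral_complex_ofReal]
  rw [this, ← integral_sub he (integrable_finsetSum _ fun k _ => hk k), ← integral_const_mul]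
  refine norm_integral_le_of_norm_le ((hν (2 * m)).const_mul _) (.of_forall fun x => ?_)
  have h := norm_exp_I_sub_sum_le (2 * m) (t * x)
  rw [(even_two_mul m).pow_abs, mul_pow] at h
  convert h using 1
  · congr 2
    · push_cast; ring_nf
    · refine Finset.sum_congr rfl fun k _ => ?_
      push_cast; ring
  · ring

/-- The method of moments, for a limit with exponential moments. -/
lemma tendsto_charFun_of_tendsto_moments (ν : ℕ → Measure ℝ) [∀ n, IsFiniteMeasure (ν n)]
    (ν₀ : Measure ℝ) [IsFiniteMeasure ν₀]
    (hν : ∀ n (k : ℕ), Integrable (fun x => x ^ k) (ν n))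
    (hν₀ : ∀ t : ℝ, Integrable (fun x => Real.exp (t * x)) ν₀)
    (h : ∀ k : ℕ, Tendsto (fun n => ∫ x, x ^ k ∂(ν n)) atTop (𝓝 (∫ x, x ^ k ∂ν₀))) (t : ℝ) :
    Tendsto (fun n => charFun (ν n) t) atTop (𝓝 (charFun ν₀ t)) := by
  have hk₀ : ∀ k : ℕ, Integrable (fun x => x ^ k) ν₀ := fun k => by
    simpa using integrable_pow_of_mem_interior_integrableExpSet (X := id) (μ := ν₀)
      (by
        have : integrableExpSet id ν₀ = Set.univ := Set.eq_univ_of_forall hν₀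
        simp [this]) k
  have hR : Tendsto (fun m : ℕ => t ^ (2 * m) / (2 * m).factorial * ∫ x, x ^ (2 * m) ∂ν₀) atTop
      (𝓝 0) := by
    have h1 : Tendsto (fun m : ℕ => ∫ x, (t * x) ^ (2 * m) / (2 * m).factorial ∂ν₀) atTop
        (𝓝 (∫ x, (0 : ℝ) ∂ν₀)) := by
      refine tendsto_integral_of_dominated_convergence (fun x => Real.exp |t * x|) ?_ ?_ ?_ ?_
      · intro m
        exact Measurable.aestronglyMeasurable (by fun_prop)
      · simp_rw [abs_mul]
        exact integrable_exp_mul_abs (X := id) (hν₀ _) (hν₀ _)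
      · refine fun m => .of_forall fun x => ?_
        rw [Real.norm_eq_abs, abs_div, abs_pow, Nat.abs_cast]
        exact Real.pow_div_factorial_le_exp _ (abs_nonneg _) _
      · refine .of_forall fun x => ?_
        exact (FloorSemiring.tendsto_pow_div_factorial_atTop (t * x)).comp
          (tendsto_id.const_mul_atTop' two_pos)
    simp only [integral_zero] at h1
    refine h1.congr fun m => ?_
    rw [← integral_const_mul]
    congr 1; ext x; ring
  rw [Metric.tendsto_atTop]
  intro ε hε
  obtain ⟨m, hm⟩ := ((Metric.tendsto_nhds.1 hR) (ε / 3) (by positivity)).exists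
  rw [Real.dist_0_eq_abs] at hm
  have hP : Tendsto (fun n => t ^ (2 * m) / (2 * m).factorial * ∫ x, x ^ (2 * m) ∂(ν n) +
      (t ^ (2 * m) / (2 * m).factorial * ∫ x, x ^ (2 * m) ∂ν₀) +
      ‖∑ k ∈ Finset.range (2 * m),
        (t * Complex.I) ^ k / (k.factorial : ℂ) * ((∫ x, x ^ k ∂(ν n) : ℝ) : ℂ) -
      ∑ k ∈ Finset.range (2 * m),
        (t * Complex.I) ^ k / (k.factorial : ℂ) * ((∫ x, x ^ k ∂ν₀ : ℝ) : ℂ)‖) atTop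
      (𝓝 (t ^ (2 * m) / (2 * m).factorial * ∫ x, x ^ (2 * m) ∂ν₀ +
        (t ^ (2 * m) / (2 * m).factorial * ∫ x, x ^ (2 * m) ∂ν₀) + 0)) := by
    refine (((h (2 * m)).const_mul _).add_const _).add ?_
    refine tendsto_zero_iff_norm_tendsto_zero.1 (tendsto_sub_nhds_zero_iff.2 ?_)
    exact tendsto_finsetSum _ fun k _ =>
      (((Complex.continuous_ofReal.tendsto _).comp (h k)).const_mul _)
  have hlt : t ^ (2 * m) / (2 * m).factorial * ∫ x, x ^ (2 * m) ∂ν₀ +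
        (t ^ (2 * m) / (2 * m).factorial * ∫ x, x ^ (2 * m) ∂ν₀) + 0 < ε := by
    linarith [le_abs_self (t ^ (2 * m) / (2 * m).factorial * ∫ x, x ^ (2 * m) ∂ν₀)]
  obtain ⟨N, hN⟩ := eventually_atTop.1 (hP.eventually_lt_const hlt)
  refine ⟨N, fun n hn => lt_of_le_of_lt ?_ (hN n hn)⟩
  have h1 := norm_charFun_sub_sum_moments_le (ν n) (hν n) t m
  have h2 := norm_charFun_sub_sum_moments_le ν₀ hk₀ t m
  rw [dist_eq_norm]
  set A := ∑ k ∈ Finset.range (2 * m),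
        (t * Complex.I) ^ k / (k.factorial : ℂ) * ((∫ x, x ^ k ∂(ν n) : ℝ) : ℂ)
  set B := ∑ k ∈ Finset.range (2 * m),
        (t * Complex.I) ^ k / (k.factorial : ℂ) * ((∫ x, x ^ k ∂ν₀ : ℝ) : ℂ)
  calc ‖charFun (ν n) t - charFun ν₀ t‖
      = ‖(charFun (ν n) t - A) - (charFun ν₀ t - B) + (A - B)‖ := by congr 1; ring
    _ ≤ ‖(charFun (ν n) t - A) - (charFun ν₀ t - B)‖ + ‖A - B‖ := norm_add_le _ _
    _ ≤ _ := by gcongr; exact (norm_sub_le _ _).trans (add_le_add h1 h2)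

namespace OrderedFinpartition

variable {n : ℕ} (c : OrderedFinpartition n)

/-- A block of an ordered finpartition, as a finset. -/
def block (j : Fin c.length) : Finset (Fin n) :=
  Finset.univ.map ⟨c.emb j, (c.emb_strictMono j).injective⟩

lemma coe_block (j : Fin c.length) : (c.block j : Set (Fin n)) = Set.range (c.emb j) := by
  simp [block]

lemma card_block (j : Fin c.length) : (c.block j).card = c.partSize j := by simp [block]

lemma block_nonempty (j : Fin c.length) : (c.block j).Nonempty := by
  rw [← Finset.card_pos, card_block]
  exact c.partSize_pos j

lemma disjoint_block {i j : Fin c.length} (h : i ≠ j) : Disjoint (c.block i) (c.block j) := by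
  rw [← Finset.disjoint_coe, coe_block, coe_block]
  exact c.disjoint (Set.mem_univ i) (Set.mem_univ j) h

lemma block_injective : Function.Injective c.block := by
  intro i j h
  by_contra hij
  have := c.disjoint_block hij
  rw [h, disjoint_self] at this
  exact (c.block_nonempty j).ne_empty this

lemma max_block (j : Fin c.length) : (c.block j).max' (c.block_nonempty j) =
    c.emb j ⟨c.partSize j - 1, Nat.sub_one_lt_of_lt (c.partSize_pos j)⟩ := by
  refine le_antisymm (Finset.max'_le _ _ _ ?_) (Finset.le_max' _ _ ?_)
  · intro y hy
    obtain ⟨a, rfl⟩ : y ∈ Set.range (c.emb j) := by rw [← coe_block]; exact hy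
    exact (c.emb_strictMono j).monotone (Fin.mk_le_mk.2 (Nat.le_sub_one_of_lt a.2))
  · rw [← Finset.mem_coe, coe_block]
    exact Set.mem_range_self _

lemma strictMono_max_block :
    StrictMono fun j => (c.block j).max' (c.block_nonempty j) := by
  simp_rw [max_block]
  exact c.parts_strictMono

/-- The set of blocks of an ordered finpartition. -/
def blocks : Finset (Finset (Fin n)) := Finset.univ.map ⟨c.block, c.block_injective⟩

lemma card_blocks : c.blocks.card = c.length := by simp [blocks]

lemma prod_blocks (m : Finset (Fin n) → ℝ) : ∏ I ∈ c.blocks, m I = ∏ j, m (c.block j) := by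
  simp [blocks]

lemma ext_block {c c' : OrderedFinpartition n} (hl : c.length = c'.length)
    (h : ∀ j, c.block j = c'.block (Fin.cast hl j)) : c = c' := by
  obtain ⟨l, s, _, e, he, _, _, _⟩ := c
  obtain ⟨l', s', _, e', he', _, _, _⟩ := c'
  obtain rfl : l = l' := hl
  obtain rfl : s = s' := by
    ext j
    simpa [block] using congrArg Finset.card (h j)
  obtain rfl : e = e' := by
    ext1 j
    refine ((he j).range_inj (he' j)).1 ?_
    simpa [block] using congrArg (fun s : Finset (Fin n) => (s : Set (Fin n))) (h j)
  rfl

lemma blocks_injective : Function.Injective (blocks (n := n)) := by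
  intro c c' h
  have hl : c.length = c'.length := by rw [← card_blocks, h, card_blocks]
  have hmem : ∀ j, ∃ j', c'.block j' = c.block j := by
    intro j
    have : c.block j ∈ c'.blocks := by rw [← h]; simp [blocks]
    simpa [blocks] using this
  choose k hk using hmem
  have hkm : StrictMono k := by
    intro i j hij
    rw [← c'.strictMono_max_block.lt_iff_lt]
    simpa [hk] using c.strictMono_max_block hij
  refine ext_block hl fun j => ?_
  have hk' : StrictMono fun j : Fin c.length => Fin.cast hl j := fun _ _ h => h
  have : k = fun j => Fin.cast hl j := by
    refine (hkm.range_inj hk').1 ?_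
    have h1 : Function.Surjective k :=
      ((Fintype.bijective_iff_injective_and_card k).2 ⟨hkm.injective, by simpa using hl⟩).2
    have h2 : Function.Surjective fun j : Fin c.length => Fin.cast hl j :=
      (finCongr hl).surjective
    rw [h1.range_eq, h2.range_eq]
  rw [← hk j, this]

lemma exists_blocks_eq (Q : Finset (Finset (Fin n))) (h0 : ∅ ∉ Q)
    (hd : ∀ I ∈ Q, ∀ J ∈ Q, I ≠ J → Disjoint I J) (hs : Q.sup id = Finset.univ) :
    ∃ c : OrderedFinpartition n, c.blocks = Q := by
  have hne : ∀ I : Q, (I : Finset (Fin n)).Nonempty := fun I =>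
    Finset.nonempty_iff_ne_empty.2 fun h => h0 (h ▸ I.2)
  let M : Q → Fin n := fun I => (I : Finset (Fin n)).max' (hne I)
  have hM : Function.Injective M := by
    intro I J h
    by_contra hIJ
    have := hd I I.2 J J.2 fun h => hIJ (Subtype.ext h)
    refine Finset.disjoint_left.1 this (Finset.max'_mem _ (hne I)) ?_
    change M I ∈ (J : Finset (Fin n))
    rw [h]
    exact Finset.max'_mem _ (hne J)
  let S : Finset (Fin n) := Finset.univ.map ⟨M, hM⟩
  have hS : S.card = Q.card := by simp [S]
  have hex : ∀ j : Fin Q.card, ∃ I : Q, M I = S.orderEmbOfFin hS j := by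
    intro j
    have hj : S.orderEmbOfFin hS j ∈ Finset.univ.map ⟨M, hM⟩ := Finset.orderEmbOfFin_mem S hS j
    obtain ⟨I, -, hI⟩ := Finset.mem_map.1 hj
    exact ⟨I, hI⟩
  choose B hB using hex
  have hBi : Function.Injective B := by
    intro i j h
    apply (S.orderEmbOfFin hS).injective
    rw [← hB, ← hB, h]
  have hBs : Function.Surjective B :=
    ((Fintype.bijective_iff_injective_and_card B).2 ⟨hBi, by simp⟩).2
  refine ⟨{
    length := Q.card
    partSize := fun j => (B j : Finset (Fin n)).card
    partSize_pos := fun j => Finset.card_pos.2 (hne (B j))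
    emb := fun j => (B j : Finset (Fin n)).orderEmbOfFin rfl
    emb_strictMono := fun j => OrderEmbedding.strictMono _
    parts_strictMono := ?_
    disjoint := ?_
    cover := ?_ }, ?_⟩
  · intro i j hij
    have hmax : ∀ j, (B j : Finset (Fin n)).orderEmbOfFin rfl
        ⟨(B j : Finset (Fin n)).card - 1,
          Nat.sub_one_lt_of_lt (Finset.card_pos.2 (hne (B j)))⟩ = S.orderEmbOfFin hS j := by
      intro j
      rw [← hB]
      exact Finset.orderEmbOfFin_last rfl (Finset.card_pos.2 (hne (B j)))
    simp only [hmax]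
    exact (S.orderEmbOfFin hS).strictMono hij
  · intro i _ j _ hij
    simp only [Function.onFun, Finset.range_orderEmbOfFin, Finset.disjoint_coe]
    exact hd _ (B i).2 _ (B j).2 fun h => hij (hBi (Subtype.ext h))
  · intro x
    have hx : x ∈ Q.sup id := by rw [hs]; exact Finset.mem_univ x
    obtain ⟨I, hI, hxI⟩ := Finset.mem_sup.1 hx
    obtain ⟨j, hj⟩ := hBs ⟨I, hI⟩
    refine ⟨j, ?_⟩
    rw [Finset.range_orderEmbOfFin, hj]
    exact hxI
  · ext I
    simp only [blocks, block, Finset.mem_map, Finset.mem_univ, true_and,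
      Function.Embedding.coeFn_mk]
    have hblock : ∀ j, Finset.univ.map ⟨(B j : Finset (Fin n)).orderEmbOfFin rfl,
        ((B j : Finset (Fin n)).orderEmbOfFin rfl).injective⟩ = (B j : Finset (Fin n)) := by
      intro j
      rw [← Finset.coe_inj]
      simp
    constructor
    · rintro ⟨j, rfl⟩
      rw [hblock]
      exact (B j).2
    · intro hI
      obtain ⟨j, hj⟩ := hBs ⟨I, hI⟩
      exact ⟨j, by rw [hblock, hj]⟩

lemma empty_notMem_blocks : ∅ ∉ c.blocks := by
  simp only [blocks, Finset.mem_map, Finset.mem_univ, true_and, Function.Embedding.coeFn_mk,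
    not_exists]
  exact fun j => (c.block_nonempty j).ne_empty

lemma disjoint_of_mem_blocks {I J : Finset (Fin n)} (hI : I ∈ c.blocks) (hJ : J ∈ c.blocks)
    (h : I ≠ J) : Disjoint I J := by
  simp only [blocks, Finset.mem_map, Finset.mem_univ, true_and,
    Function.Embedding.coeFn_mk] at hI hJ
  obtain ⟨i, rfl⟩ := hI
  obtain ⟨j, rfl⟩ := hJ
  exact c.disjoint_block fun hij => h (congrArg c.block hij)

lemma sup_blocks : c.blocks.sup id = Finset.univ := by
  ext x
  obtain ⟨j, hj⟩ := c.cover x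
  rw [← coe_block] at hj
  simp only [Finset.mem_univ, iff_true, Finset.mem_sup]
  exact ⟨c.block j, by simp [blocks], hj⟩

end OrderedFinpartition

open scoped Classical in
/-- The set partitions of `Fin r`. -/
noncomputable def setPartitions (r : ℕ) : Finset (Finset (Finset (Fin r))) :=
  Finset.univ.filter (fun Q : Finset (Finset (Fin r)) =>
      (∅ ∉ Q) ∧ (∀ I ∈ Q, ∀ J ∈ Q, I ≠ J → Disjoint I J) ∧ (Q.sup id = Finset.univ))

lemma mem_setPartitions {r : ℕ} {Q : Finset (Finset (Fin r))} : Q ∈ setPartitions r ↔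
    (∅ ∉ Q) ∧ (∀ I ∈ Q, ∀ J ∈ Q, I ≠ J → Disjoint I J) ∧ (Q.sup id = Finset.univ) := by
  simp [setPartitions]

lemma sum_orderedFinpartition_eq_sum_setPartitions {r : ℕ} (a m : ℕ → ℝ) :
    ∑ c : OrderedFinpartition r, a c.length * ∏ j, m (c.partSize j) =
      ∑ Q ∈ setPartitions r, a Q.card * ∏ I ∈ Q, m I.card := by
  refine Finset.sum_bij (fun c _ => c.blocks) ?_ ?_ ?_ ?_
  · exact fun c _ => mem_setPartitions.2
      ⟨c.empty_notMem_blocks, fun I hI J hJ => c.disjoint_of_mem_blocks hI hJ, c.sup_blocks⟩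
  · exact fun c _ c' _ h => OrderedFinpartition.blocks_injective h
  · intro Q hQ
    obtain ⟨h0, hd, hs⟩ := mem_setPartitions.1 hQ
    obtain ⟨c, hc⟩ := OrderedFinpartition.exists_blocks_eq Q h0 hd hs
    exact ⟨c, Finset.mem_univ c, hc⟩
  · intro c _
    simp [c.card_blocks, c.prod_blocks, c.card_block]

/-- The cumulant of order `r` attached to a sequence of moments. -/
noncomputable def momentCumulant (r : ℕ) (m : ℕ → ℝ) : ℝ :=
  ∑ Q ∈ setPartitions r,
    (-1 : ℝ) ^ (Q.card - 1) * (Nat.factorial (Q.card - 1)) * ∏ I ∈ Q, m I.card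

lemma iteratedDeriv_log_one {p : ℕ} (hp : p ≠ 0) :
    iteratedDeriv p Real.log 1 = (-1 : ℝ) ^ (p - 1) * (Nat.factorial (p - 1)) := by
  obtain ⟨k, rfl⟩ := Nat.exists_eq_succ_of_ne_zero hp
  rw [Nat.succ_eq_add_one, iteratedDeriv_succ', Real.deriv_log', iteratedDeriv_eq_iterate]
  simp

/-- The moment-cumulant formula. -/
lemma iteratedDeriv_cgf_zero {Ω : Type*} [MeasurableSpace Ω] {P : Measure Ω}
    [IsProbabilityMeasure P] {X : Ω → ℝ} (h : 0 ∈ interior (integrableExpSet X P)) {r : ℕ}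
    (hr : r ≠ 0) :
    iteratedDeriv r (cgf X P) 0 = momentCumulant r fun k => ∫ x, X x ^ k ∂P := by
  have hM : mgf X P 0 = 1 := by simp
  have hg : ContDiffAt ℝ r Real.log (mgf X P 0) := by
    rw [hM]; exact Real.contDiffAt_log.2 one_ne_zero
  have hf : ContDiffAt ℝ r (mgf X P) 0 := (analyticAt_mgf h).contDiffAt
  have : cgf X P = Real.log ∘ mgf X P := rfl
  rw [this, iteratedDeriv_comp_eq_sum_orderedFinpartition hg hf le_rfl, hM, momentCumulant,
    ← sum_orderedFinpartition_eq_sum_setPartitions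
      (fun p => (-1 : ℝ) ^ (p - 1) * (Nat.factorial (p - 1))) fun k => ∫ x, X x ^ k ∂P]
  refine Finset.sum_congr rfl fun c _ => ?_
  rw [iteratedDeriv_log_one (c.length_pos (Nat.pos_of_ne_zero hr)).ne']
  congr 1
  exact Finset.prod_congr rfl fun j _ => iteratedDeriv_mgf_zero h _

lemma univ_mem_setPartitions {r : ℕ} (hr : r ≠ 0) : {Finset.univ} ∈ setPartitions r := by
  have : NeZero r := ⟨hr⟩
  rw [mem_setPartitions]
  refine ⟨?_, ?_, by simp⟩
  · simpa using (Finset.univ_nonempty (α := Fin r)).ne_empty.symm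
  · intro I hI J hJ h
    simp only [Finset.mem_singleton] at hI hJ
    exact absurd (hI.trans hJ.symm) h

lemma card_lt_of_mem_setPartitions {r : ℕ} {Q : Finset (Finset (Fin r))}
    (hQ : Q ∈ setPartitions r) (hne : Q ≠ {Finset.univ}) {I : Finset (Fin r)} (hI : I ∈ Q) :
    I.card < r := by
  obtain ⟨h0, hd, -⟩ := mem_setPartitions.1 hQ
  refine lt_of_le_of_ne (by simpa using I.card_le_univ) fun h => hne ?_
  have hIu : I = Finset.univ := (Finset.card_eq_iff_eq_univ I).1 (by simpa using h)
  subst hIu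
  refine Finset.eq_singleton_iff_unique_mem.2 ⟨hI, fun J hJ => ?_⟩
  by_contra hJI
  have hdis := hd J hJ _ hI hJI
  rw [← Finset.top_eq_univ, disjoint_top, Finset.bot_eq_empty] at hdis
  exact h0 (hdis ▸ hJ)

lemma momentCumulant_eq_add {r : ℕ} (hr : r ≠ 0) (m : ℕ → ℝ) :
    momentCumulant r m = m r + ∑ Q ∈ (setPartitions r).erase {Finset.univ},
      (-1 : ℝ) ^ (Q.card - 1) * (Nat.factorial (Q.card - 1)) * ∏ I ∈ Q, m I.card := by
  rw [momentCumulant, ← Finset.add_sum_erase _ _ (univ_mem_setPartitions hr)]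
  simp

/-- Convergence of cumulants implies convergence of moments. -/
lemma tendsto_moments_of_tendsto_momentCumulant (m : ℕ → ℕ → ℝ) (m₀ : ℕ → ℝ)
    (h : ∀ r, r ≠ 0 →
      Tendsto (fun n => momentCumulant r (m n)) atTop (𝓝 (momentCumulant r m₀)))
    (r : ℕ) (hr : r ≠ 0) : Tendsto (fun n => m n r) atTop (𝓝 (m₀ r)) := by
  induction r using Nat.strong_induction_on with
  | _ r ih =>
    have key : Tendsto (fun n => ∑ Q ∈ (setPartitions r).erase {Finset.univ},
        (-1 : ℝ) ^ (Q.card - 1) * (Nat.factorial (Q.card - 1)) * ∏ I ∈ Q, m n I.card) atTop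
        (𝓝 (∑ Q ∈ (setPartitions r).erase {Finset.univ},
          (-1 : ℝ) ^ (Q.card - 1) * (Nat.factorial (Q.card - 1)) * ∏ I ∈ Q, m₀ I.card)) := by
      refine tendsto_finsetSum _ fun Q hQ => (tendsto_finsetProd _ fun I hI => ?_).const_mul _
      rw [Finset.mem_erase] at hQ
      refine ih _ (card_lt_of_mem_setPartitions hQ.2 hQ.1 hI) ?_
      rw [Finset.card_ne_zero, Finset.nonempty_iff_ne_empty]
      exact fun h => (mem_setPartitions.1 hQ.2).1 (h ▸ hI)
    have := (h r hr).sub key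
    simpa [momentCumulant_eq_add hr] using this

lemma iteratedDeriv_const_mul_sq_zero (v : ℝ) {r : ℕ} (hr : r ≠ 0) :
    iteratedDeriv r (fun t : ℝ => v * t ^ 2 / 2) 0 = if r = 2 then v else 0 := by
  have h0 : deriv (fun t : ℝ => v * t ^ 2 / 2) = fun t => v * t := by
    ext t
    simp
    ring
  have h1 : deriv (fun t : ℝ => v * t) = fun _ => v := by
    ext t
    simp
  obtain _ | _ | k := r
  · exact absurd rfl hr
  · simp
  · rw [iteratedDeriv_succ', iteratedDeriv_succ', h0, h1, iteratedDeriv_const]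
    simp

lemma momentCumulant_gaussianReal (v : NNReal) {r : ℕ} (hr : r ≠ 0) :
    momentCumulant r (fun k => ∫ x, x ^ k ∂(gaussianReal 0 v)) = if r = 2 then (v : ℝ) else 0 := by
  have h : (0 : ℝ) ∈ interior (integrableExpSet id (gaussianReal 0 v)) := by simp
  have := iteratedDeriv_cgf_zero h hr
  rw [show cgf id (gaussianReal 0 v) = fun t : ℝ => (v : ℝ) * t ^ 2 / 2 by
    ext t
    rw [cgf_gaussianReal (μ := 0) (v := v) Measure.map_id]
    simp] at this
  rw [← iteratedDeriv_const_mul_sq_zero _ hr, this]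
  rfl

lemma momentCumulant_of_le_two {m : ℕ → ℝ} (hm : m 1 = 0) {r : ℕ} (hr : r ≠ 0) (hr2 : r ≤ 2) :
    momentCumulant r m = m r := by
  rw [momentCumulant_eq_add hr, Finset.sum_eq_zero, add_zero]
  intro Q hQ
  rw [Finset.mem_erase] at hQ
  have : NeZero r := ⟨hr⟩
  obtain ⟨h0, -, hs⟩ := mem_setPartitions.1 hQ.2
  have hQe : Q ≠ ∅ := by
    rintro rfl
    exact (Finset.univ_nonempty (α := Fin r)).ne_empty (by simpa using hs.symm)
  obtain ⟨I, hI⟩ := Finset.nonempty_iff_ne_empty.2 hQe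
  have hlt := card_lt_of_mem_setPartitions hQ.2 hQ.1 hI
  have hI0 : I.card ≠ 0 := by
    rw [Finset.card_ne_zero, Finset.nonempty_iff_ne_empty]
    exact fun h => h0 (h ▸ hI)
  rw [Finset.prod_eq_zero hI (by rw [show I.card = 1 by omega, hm]), mul_zero]

lemma hasSum_integral_of_norm_le {ι Ω F : Type*} [Countable ι] [MeasurableSpace Ω]
    [NormedAddCommGroup F] [NormedSpace ℝ F] (P : Measure Ω) [IsProbabilityMeasure P]
    {G : ι → Ω → F} (hG : ∀ i, AEStronglyMeasurable (G i) P) {u : ι → ℝ} (hu : Summable u)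
    (hGu : ∀ i x, ‖G i x‖ ≤ u i) :
    HasSum (fun i => ∫ x, G i x ∂P) (∫ x, ∑' i, G i x ∂P) := by
  have hinteg : ∀ i, Integrable (G i) P := fun i =>
    Integrable.of_bound (hG i) (u i) (.of_forall (hGu i))
  refine hasSum_integral_of_summable_integral_norm hinteg
    (hu.of_nonneg_of_le (fun i => integral_nonneg fun x => norm_nonneg _) fun i => ?_)
  calc ∫ x, ‖G i x‖ ∂P ≤ ∫ _, u i ∂P :=
        integral_mono (hinteg i).norm (integrable_const _) (hGu i)
    _ = u i := by simp

lemma norm_const_mul_le {ι E : Type*} {X : ι → E → ℝ} {C : ℝ}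
    (hC : ∀ ℓ x, |X ℓ x| ≤ C) (w : ι → ℝ) (ℓ : ι) (x : E) : ‖w ℓ * X ℓ x‖ ≤ |w ℓ| * C := by
  rw [norm_mul]
  exact mul_le_mul_of_nonneg_left (hC ℓ x) (abs_nonneg _)

section WeightedSums

variable {ι E : Type*} [MeasurableSpace E]

lemma jointCumulant_eq_sum_setPartitions (μ : Measure E) {r : ℕ} (Y : Fin r → E → ℝ) :
    jointCumulant μ Y = ∑ Q ∈ setPartitions r,
      (-1 : ℝ) ^ (Q.card - 1) * (Nat.factorial (Q.card - 1)) *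
        ∏ I ∈ Q, ∫ x, ∏ i ∈ I, Y i x ∂μ := rfl

lemma jointCumulant_const (μ : Measure E) (r : ℕ) (Z : E → ℝ) :
    jointCumulant μ (fun _ : Fin r => Z) = momentCumulant r fun k => ∫ x, Z x ^ k ∂μ := by
  simp [jointCumulant_eq_sum_setPartitions, momentCumulant]

variable [Countable ι] (μ : Measure E) [IsProbabilityMeasure μ] {X : ι → E → ℝ}
  (hX : ∀ ℓ, Measurable (X ℓ)) {C : ℝ} (hC : ∀ ℓ x, |X ℓ x| ≤ C) {w : ι → ℝ}
  (hw : Summable fun ℓ => |w ℓ|)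

include hX hC hw

lemma summable_weighted_and_measurable_tsum :
    (∀ x, Summable fun ℓ => ‖w ℓ * X ℓ x‖) ∧ (Measurable fun x => ∑' ℓ, w ℓ * X ℓ x) ∧
      ∀ x, |∑' ℓ, w ℓ * X ℓ x| ≤ ∑' ℓ, |w ℓ| * C := by
  have hs : ∀ x, Summable fun ℓ => ‖w ℓ * X ℓ x‖ := fun x =>
    (hw.mul_right C).of_nonneg_of_le (fun _ => norm_nonneg _)
      fun ℓ => norm_const_mul_le hC w ℓ x
  refine ⟨hs, Measurable.tsum fun ℓ => (hX ℓ).const_mul _, fun x => ?_⟩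
  exact tsum_of_norm_bounded (hw.mul_right C).hasSum fun ℓ => norm_const_mul_le hC w ℓ x

lemma integral_tsum_weighted :
    ∫ x, ∑' ℓ, w ℓ * X ℓ x ∂μ = ∑' ℓ, w ℓ * ∫ x, X ℓ x ∂μ := by
  rw [← (hasSum_integral_of_norm_le μ (fun ℓ => ((hX ℓ).const_mul _).aestronglyMeasurable)
    (hw.mul_right C) (norm_const_mul_le hC w)).tsum_eq]
  simp_rw [integral_const_mul]

lemma integral_tsum_weighted_sq :
    ∫ x, (∑' ℓ, w ℓ * X ℓ x) ^ 2 ∂μ =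
      ∑' p : ι × ι, w p.1 * w p.2 * ∫ x, X p.1 x * X p.2 x ∂μ := by
  have hs := (summable_weighted_and_measurable_tsum hX hC hw).1
  have hwC : Summable fun ℓ => ‖|w ℓ| * C‖ := (hw.mul_right C).norm
  have h := hasSum_integral_of_norm_le μ (G := fun (p : ι × ι) x =>
      (w p.1 * X p.1 x) * (w p.2 * X p.2 x))
    (fun p => (((hX _).const_mul _).mul ((hX _).const_mul _)).aestronglyMeasurable)
    (hwC.mul_norm hwC) fun p x => by
      rw [norm_mul (w p.1 * X p.1 x), norm_mul (|w p.1| * C)]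
      exact mul_le_mul ((norm_const_mul_le hC w _ x).trans (le_abs_self _))
        ((norm_const_mul_le hC w _ x).trans (le_abs_self _)) (norm_nonneg _) (abs_nonneg _)
  have h2 : ∀ x, (∑' ℓ, w ℓ * X ℓ x) ^ 2 =
      ∑' p : ι × ι, (w p.1 * X p.1 x) * (w p.2 * X p.2 x) := fun x => by
    rw [sq, tsum_mul_tsum_of_summable_norm (hs x) (hs x)]
  simp_rw [h2]
  rw [← h.tsum_eq]
  refine tsum_congr fun p => ?_
  rw [← integral_const_mul]
  congr 1; ext x; ring

lemma hasSum_prod_blocks {r : ℕ} {Q : Finset (Finset (Fin r))} (hQ : Q ∈ setPartitions r) :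
    HasSum (fun L : Fin r → ι => (∏ i, w (L i)) * ∏ I ∈ Q, ∫ x, ∏ i ∈ I, X (L i) x ∂μ)
      (∏ I ∈ Q, ∫ x, ∏ _i ∈ I, ∑' ℓ, w ℓ * X ℓ x ∂μ) := by
  classical
  obtain ⟨-, hd, hsup⟩ := mem_setPartitions.1 hQ
  have hex : ∀ i : Fin r, ∃ I : Q, i ∈ (I : Finset (Fin r)) := fun i => by
    have hi : i ∈ Q.sup id := hsup ▸ Finset.mem_univ i
    obtain ⟨I, hI, hiI⟩ := Finset.mem_sup.1 hi
    exact ⟨⟨I, hI⟩, hiI⟩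
  choose b hb using hex
  have hfib : ∀ I : Q, Finset.univ.filter (fun i => b i = I) = (I : Finset (Fin r)) := by
    intro I
    ext i
    simp only [Finset.mem_filter, Finset.mem_univ, true_and]
    refine ⟨fun h => h ▸ hb i, fun hi => ?_⟩
    by_contra hne
    exact Finset.disjoint_left.1 (hd _ (b i).2 _ I.2 fun h => hne (Subtype.ext h)) (hb i) hi
  have hprod : ∀ h : Q → Fin r → ℝ,
      ∏ I : Q, ∏ i ∈ (I : Finset (Fin r)), h I i = ∏ i, h (b i) i := by
    intro h
    rw [← Finset.prod_fiberwise Finset.univ b]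
    refine Finset.prod_congr rfl fun I _ => ?_
    rw [hfib I]
    refine Finset.prod_congr rfl fun i hi => ?_
    rw [← hfib I, Finset.mem_filter] at hi
    rw [hi.2]
  obtain ⟨hs, hmeas, -⟩ := summable_weighted_and_measurable_tsum hX hC hw
  have hwC : Summable fun ℓ => ‖|w ℓ| * C‖ := (hw.mul_right C).norm
  have h := hasSum_integral_of_norm_le (Measure.pi fun _ : Q => μ)
    (G := fun (L : Fin r → ι) (y : Q → E) => ∏ i, (w (L i) * X (L i) (y (b i))))
    (fun L => (Finset.measurable_fun_prod _ fun i _ =>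
      ((hX _).comp (measurable_pi_apply _)).const_mul _).aestronglyMeasurable)
    (summable_and_tsum_pi_prod (fun _ ℓ => |w ℓ| * C) fun _ => hwC).1 fun L y => by
      rw [norm_prod, norm_prod]
      exact Finset.prod_le_prod (fun _ _ => norm_nonneg _) fun i _ =>
        (norm_const_mul_le hC w _ _).trans (le_abs_self _)
  have hterm : ∀ L : Fin r → ι,
      ∫ y, ∏ i, (w (L i) * X (L i) (y (b i))) ∂(Measure.pi fun _ : Q => μ) =
        (∏ i, w (L i)) * ∏ I ∈ Q, ∫ x, ∏ i ∈ I, X (L i) x ∂μ := fun L => by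
    rw [← Finset.prod_coe_sort Q fun I => ∫ x, ∏ i ∈ I, X (L i) x ∂μ,
      ← integral_fintype_prod_eq_prod (μ := fun _ : Q => μ)
        fun (I : Q) x => ∏ i ∈ (I : Finset (Fin r)), X (L i) x, ← integral_const_mul]
    congr 1
    ext y
    rw [Finset.prod_mul_distrib, hprod fun I i => X (L i) (y I)]
  have hlim : ∫ y, ∑' L : Fin r → ι, ∏ i, (w (L i) * X (L i) (y (b i)))
      ∂(Measure.pi fun _ : Q => μ) =
        ∏ I ∈ Q, ∫ x, ∏ _i ∈ I, ∑' ℓ, w ℓ * X ℓ x ∂μ := by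
    rw [← Finset.prod_coe_sort Q fun I => ∫ x, ∏ _i ∈ I, ∑' ℓ, w ℓ * X ℓ x ∂μ,
      ← integral_fintype_prod_eq_prod (μ := fun _ : Q => μ)
        fun (I : Q) x => ∏ _i ∈ (I : Finset (Fin r)), ∑' ℓ, w ℓ * X ℓ x]
    congr 1
    ext y
    rw [(summable_and_tsum_pi_prod (fun i ℓ => w ℓ * X ℓ (y (b i))) fun i => hs _).2,
      hprod fun I _ => ∑' ℓ, w ℓ * X ℓ (y I)]
  rw [← hlim]
  simp_rw [← hterm]
  exact h

/-- Multilinearity of the joint cumulant along absolutely convergent series. -/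
lemma tsum_jointCumulant (r : ℕ) :
    ∑' L : Fin r → ι, (∏ i, w (L i)) * jointCumulant μ (fun i => X (L i)) =
      momentCumulant r fun k => ∫ x, (∑' ℓ, w ℓ * X ℓ x) ^ k ∂μ := by
  rw [← jointCumulant_const]
  refine HasSum.tsum_eq ?_
  simp_rw [jointCumulant_eq_sum_setPartitions, Finset.mul_sum]
  refine hasSum_sum fun Q hQ => ?_
  refine ((hasSum_prod_blocks μ hX hC hw hQ).mul_left
    ((-1 : ℝ) ^ (Q.card - 1) * (Nat.factorial (Q.card - 1)))).congr_fun fun L => ?_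
  ring

end WeightedSums

section Torus

variable {d : ℕ}

lemma torusChar_eq_prod (ℓ : Fin d → ℤ) (t : Fin d → AddCircle (1 : ℝ)) :
    torusChar ℓ t = ∏ j, fourier (ℓ j) (t j) := by
  have h : ∀ s : Finset (Fin d), AddCircle.toCircle (∑ j ∈ s, ℓ j • t j) =
      ∏ j ∈ s, AddCircle.toCircle (ℓ j • t j) := fun s => by
    induction s using Finset.cons_induction with
    | empty => simp
    | cons j s hj ih => rw [Finset.sum_cons, Finset.prod_cons, AddCircle.toCircle_add, ih]
  rw [torusChar, h]
  exact map_prod Circle.coeHom _ _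

lemma norm_torusChar (ℓ : Fin d → ℤ) (t : Fin d → AddCircle (1 : ℝ)) : ‖torusChar ℓ t‖ = 1 :=
  Circle.norm_coe _

lemma continuous_torusChar (ℓ : Fin d → ℤ) : Continuous (torusChar ℓ) := by
  simp_rw [funext (torusChar_eq_prod ℓ)]
  fun_prop

lemma torusChar_add (ℓ ℓ' : Fin d → ℤ) (t : Fin d → AddCircle (1 : ℝ)) :
    torusChar (ℓ + ℓ') t = torusChar ℓ t * torusChar ℓ' t := by
  simp [torusChar_eq_prod, Finset.prod_mul_distrib]

lemma conj_torusChar (ℓ : Fin d → ℤ) (t : Fin d → AddCircle (1 : ℝ)) :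
    (starRingEnd ℂ) (torusChar ℓ t) = torusChar (-ℓ) t := by
  simp [torusChar_eq_prod]

instance isProbabilityMeasure_volume_unitAddCircle :
    IsProbabilityMeasure (volume : Measure (AddCircle (1 : ℝ))) :=
  ⟨by simp [AddCircle.measure_univ]⟩

instance isProbabilityMeasure_volume_torus :
    IsProbabilityMeasure (volume : Measure (Fin d → AddCircle (1 : ℝ))) := by
  rw [volume_pi]
  infer_instance

lemma integral_torusChar (ℓ : Fin d → ℤ) :
    ∫ t : Fin d → AddCircle (1 : ℝ), torusChar ℓ t = if ℓ = 0 then 1 else 0 := by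
  simp_rw [torusChar_eq_prod]
  split_ifs with h
  · simp [h]
  · rw [integral_fintype_prod_volume_eq_prod fun j t => fourier (ℓ j) t]
    obtain ⟨j, hj⟩ := Function.ne_iff.1 h
    exact Finset.prod_eq_zero (Finset.mem_univ j) (integral_eq_zero_of_add_right_eq_neg
      (fourier_add_half_inv_index hj one_pos))

lemma continuous_specDensity {a : (Fin d → ℤ) → ℝ} (ha : Summable fun ℓ => |a ℓ|) :
    Continuous (specDensity a) := by
  refine Complex.continuous_re.comp (continuous_tsum
    (fun ℓ => continuous_const.mul (continuous_torusChar ℓ)) ha fun ℓ t => ?_)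
  simp [norm_torusChar]

lemma integral_normKernel_mul_specDensity {w a : (Fin d → ℤ) → ℝ}
    (hw : Summable fun ℓ => |w ℓ|) (ha : Summable fun ℓ => |a ℓ|) :
    ∫ t, normKernel w t * specDensity a t =
      (∑' ℓ, w ℓ ^ 2)⁻¹ *
        ∑' p : (Fin d → ℤ) × (Fin d → ℤ), w p.1 * w p.2 * a (p.2 - p.1) := by
  have hn : ∀ {v : (Fin d → ℤ) → ℝ}, (Summable fun ℓ => |v ℓ|) →
      ∀ t, Summable fun ℓ => ‖(v ℓ : ℂ) * torusChar ℓ t‖ := fun hv t => by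
    simpa [norm_torusChar] using hv
  have hn' : ∀ t, Summable fun ℓ => ‖(w ℓ : ℂ) * torusChar (-ℓ) t‖ := fun t => by
    simpa [norm_torusChar] using hw
  let G : ((Fin d → ℤ) × (Fin d → ℤ)) × (Fin d → ℤ) → (Fin d → AddCircle (1 : ℝ)) → ℂ :=
    fun q t => ((w q.1.1 : ℂ) * torusChar q.1.1 t * ((w q.1.2 : ℂ) * torusChar (-q.1.2) t)) *
      ((a q.2 : ℂ) * torusChar q.2 t)
  have hu : Summable fun q : ((Fin d → ℤ) × (Fin d → ℤ)) × (Fin d → ℤ) =>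
      ‖(w q.1.1 * w q.1.2) * a q.2‖ :=
    (Summable.mul_norm (f := w) (g := w) hw hw).mul_norm ha
  have hsum := hasSum_integral_of_norm_le volume (G := G)
    (fun q => Continuous.aestronglyMeasurable (by
      have := fun ℓ => continuous_torusChar (d := d) ℓ
      fun_prop)) hu
    (fun q t => by simp [G, norm_torusChar])
  have hG : ∀ t, ∑' q, G q t = ((‖∑' ℓ, (w ℓ : ℂ) * torusChar ℓ t‖ ^ 2 : ℝ) : ℂ) *
      ∑' ℓ, (a ℓ : ℂ) * torusChar ℓ t := fun t => by
    have hconj : ∑' ℓ, (w ℓ : ℂ) * torusChar (-ℓ) t =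
        (starRingEnd ℂ) (∑' ℓ, (w ℓ : ℂ) * torusChar ℓ t) := by
      rw [Complex.conj_tsum]
      simp [conj_torusChar]
    rw [Complex.ofReal_pow, ← Complex.mul_conj', ← hconj,
      tsum_mul_tsum_of_summable_norm (hn hw t) (hn' t),
      tsum_mul_tsum_of_summable_norm ((hn hw t).mul_norm (hn' t)) (hn ha t)]
  have hGint : ∀ q, ∫ t, G q t =
      if q.2 = q.1.2 - q.1.1 then ((w q.1.1 * w q.1.2 * a q.2 : ℝ) : ℂ) else 0 := fun q => by
    have : ∀ t, G q t =
        ((w q.1.1 * w q.1.2 * a q.2 : ℝ) : ℂ) * torusChar (q.1.1 + -q.1.2 + q.2) t := fun t => by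
      simp only [G, torusChar_add]
      push_cast
      ring
    simp_rw [this]
    rw [integral_const_mul, integral_torusChar]
    have : q.1.1 + -q.1.2 + q.2 = 0 ↔ q.2 = q.1.2 - q.1.1 := by
      constructor <;> intro h
      · rw [← sub_eq_zero, ← h]; abel
      · rw [h]; abel
    simp [this]
  simp_rw [hGint, hG] at hsum
  have htsum := hsum.tsum_eq
  rw [hsum.summable.tsum_prod] at htsum
  simp_rw [tsum_ite_eq] at htsum
  rw [← Complex.ofReal_tsum] at htsum
  have hcont : Continuous fun t => ((‖∑' ℓ, (w ℓ : ℂ) * torusChar ℓ t‖ ^ 2 : ℝ) : ℂ) *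
      ∑' ℓ, (a ℓ : ℂ) * torusChar ℓ t := by
    have hc : ∀ {v : (Fin d → ℤ) → ℝ}, (Summable fun ℓ => |v ℓ|) →
        Continuous fun t => ∑' ℓ, (v ℓ : ℂ) * torusChar ℓ t := fun hv =>
      continuous_tsum (fun ℓ => continuous_const.mul (continuous_torusChar ℓ)) hv fun ℓ t => by
        simp [norm_torusChar]
    have := hc hw
    have := hc ha
    fun_prop
  have hre := integral_re (hcont.integrable_of_hasCompactSupport
    (HasCompactSupport.of_compactSpace _) (μ := volume))
  rw [← htsum] at hre
  simp only [RCLike.re_to_complex, Complex.ofReal_re, Complex.re_ofReal_mul] at hre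
  rw [← hre, ← integral_const_mul]
  congr 1
  ext t
  rw [normKernel, specDensity]
  ring

end Torus

lemma tendsto_integral_comp_of_tendsto_moments {E : Type*} [MeasurableSpace E] (μ : Measure E)
    [IsProbabilityMeasure μ] {Z : ℕ → E → ℝ} (hZ : ∀ n, Measurable (Z n))
    (hZb : ∀ n, ∃ B, ∀ x, |Z n x| ≤ B) (v : NNReal)
    (h : ∀ k, Tendsto (fun n => ∫ x, Z n x ^ k ∂μ) atTop (𝓝 (∫ x, x ^ k ∂gaussianReal 0 v)))
    (g : BoundedContinuousFunction ℝ ℝ) :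
    Tendsto (fun n => ∫ x, g (Z n x) ∂μ) atTop (𝓝 (∫ y, g y ∂gaussianReal 0 v)) := by
  have : ∀ n, IsProbabilityMeasure (μ.map (Z n)) := fun n =>
    Measure.isProbabilityMeasure_map (hZ n).aemeasurable
  have hmom : ∀ n (k : ℕ), ∫ x, x ^ k ∂(μ.map (Z n)) = ∫ x, Z n x ^ k ∂μ := fun n k =>
    integral_map (hZ n).aemeasurable (by fun_prop)
  have hinteg : ∀ n (k : ℕ), Integrable (fun x => x ^ k) (μ.map (Z n)) := fun n k => by
    obtain ⟨B, hB⟩ := hZb n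
    rw [integrable_map_measure (by fun_prop) (hZ n).aemeasurable]
    refine Integrable.of_bound ((hZ n).pow_const k).aestronglyMeasurable (B ^ k)
      (.of_forall fun x => ?_)
    rw [Function.comp_apply, norm_pow]
    exact pow_le_pow_left₀ (norm_nonneg _) (hB x) k
  have hchar := tendsto_charFun_of_tendsto_moments (fun n => μ.map (Z n)) (gaussianReal 0 v) hinteg
    (fun t => integrable_exp_mul_gaussianReal t) (by simpa only [hmom] using h)
  have hweak := ProbabilityMeasure.tendsto_iff_forall_integral_tendsto.1
    ((ProbabilityMeasure.tendsto_iff_tendsto_charFun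
      (μ := fun n => (⟨μ.map (Z n), this n⟩ : ProbabilityMeasure ℝ))
      (μ₀ := ⟨gaussianReal 0 v, inferInstance⟩)).2 hchar) g
  refine hweak.congr fun n => ?_
  exact integral_map (hZ n).aemeasurable g.continuous.aestronglyMeasurable

lemma tsum_sq_pos {ι : Type*} {w : ι → ℝ} (hw : Summable fun ℓ => |w ℓ|)
    (hpos : 0 < ∑' ℓ, |w ℓ|) : 0 < ∑' ℓ, w ℓ ^ 2 := by
  have hs : Summable fun ℓ => w ℓ ^ 2 := by
    refine (hw.mul_right (∑' ℓ, |w ℓ|)).of_nonneg_of_le (fun ℓ => sq_nonneg _) fun ℓ => ?_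
    rw [← sq_abs, sq]
    exact mul_le_mul_of_nonneg_left (hw.le_tsum ℓ fun _ _ => abs_nonneg _) (abs_nonneg _)
  obtain ⟨ℓ, hℓ⟩ : ∃ ℓ, w ℓ ≠ 0 := by
    by_contra! h
    simp [h] at hpos
  exact hs.tsum_pos (fun _ => sq_nonneg _) ℓ (by positivity)

section Action

variable {d : ℕ} {E : Type*} [MeasurableSpace E] {μ : Measure E} {T : (Fin d → ℤ) → E → E}
  (hT : ∀ ℓ, MeasurePreserving (T ℓ) μ μ) {f : E → ℝ} (hf : Measurable f)

include hT hf

lemma integral_comp_action (ℓ : Fin d → ℤ) : ∫ x, f (T ℓ x) ∂μ = ∫ x, f x ∂μ := by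
  rw [← integral_map (hT ℓ).aemeasurable hf.aestronglyMeasurable (f := f), (hT ℓ).map_eq]

lemma integral_mul_comp_action (hTadd : ∀ ℓ ℓ', T (ℓ + ℓ') = T ℓ ∘ T ℓ') (ℓ ℓ' : Fin d → ℤ) :
    ∫ x, f (T ℓ x) * f (T ℓ' x) ∂μ = ∫ x, f (T (ℓ' - ℓ) x) * f x ∂μ := by
  have hm : Measurable fun x => f (T (ℓ' - ℓ) x) * f x :=
    (hf.comp (hT _).measurable).mul hf
  rw [← integral_comp_action hT hm ℓ]
  congr 1
  ext x
  have : T ℓ' x = T (ℓ' - ℓ) (T ℓ x) := by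
    rw [← Function.comp_apply (f := T (ℓ' - ℓ)), ← hTadd, sub_add_cancel]
  rw [this, mul_comm]

end Action

/-- **CLT via cumulants.** If `(w_n)` is a `ξ`-regular summation sequence and
all normalized cumulants of order `r ≥ 3` of the weighted sums of `f∘T^ℓ` are `o((Σ w_n²)^{r/2})`,
then the normalized sums converge in distribution to `N(0, ξ(φ_f))`. -/
theorem quenched_fclt_stmt13 {d : ℕ} {E : Type*} [MeasurableSpace E]
    (μ : Measure E) [IsProbabilityMeasure μ]
    (T : (Fin d → ℤ) → E → E)
    (hT : ∀ ℓ, MeasurePreserving (T ℓ) μ μ)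
    (hT0 : T 0 = id)
    (hTadd : ∀ ℓ ℓ', T (ℓ + ℓ') = T ℓ ∘ T ℓ')
    (f : E → ℝ) (hfmeas : Measurable f) (hfbdd : ∃ C : ℝ, ∀ x, |f x| ≤ C)
    (hf0 : (∫ x, f x ∂μ) = 0)
    (hcorr : Summable (fun ℓ : Fin d → ℤ => |∫ x, f (T ℓ x) * f x ∂μ|))
    (w : ℕ → (Fin d → ℤ) → ℝ)
    (hw : ∀ n, Summable (fun ℓ => |w n ℓ|) ∧ 0 < ∑' ℓ : Fin d → ℤ, |w n ℓ|)
    (ξ : Measure (Fin d → AddCircle (1 : ℝ))) [IsProbabilityMeasure ξ]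
    -- ξ-regularity of the summation sequence
    (hreg : ∀ φ : C((Fin d → AddCircle (1 : ℝ)), ℝ),
      Tendsto (fun n => ∫ t, normKernel (w n) t * φ t) atTop (𝓝 (∫ t, φ t ∂ξ)))
    -- smallness of cumulants of order r ≥ 3
    (hcum : ∀ r : ℕ, 3 ≤ r →
      Tendsto (fun n =>
        (∑' L : Fin r → (Fin d → ℤ),
          (∏ i, w n (L i)) * jointCumulant μ (fun i x => f (T (L i) x))) /
        (∑' ℓ : Fin d → ℤ, (w n ℓ) ^ 2) ^ ((r : ℝ) / 2)) atTop (𝓝 0)) :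
    ∀ g : BoundedContinuousFunction ℝ ℝ,
      Tendsto (fun n => ∫ x,
          g ((Real.sqrt (∑' ℓ : Fin d → ℤ, (w n ℓ) ^ 2))⁻¹ *
            ∑' ℓ : Fin d → ℤ, w n ℓ * f (T ℓ x)) ∂μ)
        atTop
        (𝓝 (∫ y, g y ∂(gaussianReal 0 (Real.toNNReal
          (∫ t, specDensity (fun ℓ => ∫ x, f (T ℓ x) * f x ∂μ) t ∂ξ))))) := by
  intro g
  obtain ⟨C, hC⟩ := hfbdd
  have hX : ∀ ℓ, Measurable fun x => f (T ℓ x) := fun ℓ => hfmeas.comp (hT ℓ).measurable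
  have hXC : ∀ ℓ x, |f (T ℓ x)| ≤ C := fun ℓ x => hC _
  have hpos : ∀ n, 0 < ∑' ℓ, w n ℓ ^ 2 := fun n => tsum_sq_pos (hw n).1 (hw n).2
  set V : ℕ → ℝ := fun n => ∑' ℓ, w n ℓ ^ 2
  set a : (Fin d → ℤ) → ℝ := fun ℓ => ∫ x, f (T ℓ x) * f x ∂μ
  set Z : ℕ → E → ℝ := fun n x => (Real.sqrt (V n))⁻¹ * ∑' ℓ, w n ℓ * f (T ℓ x) with hZdef
  have hZ : ∀ n x, Z n x = ∑' ℓ, ((Real.sqrt (V n))⁻¹ * w n ℓ) * f (T ℓ x) := fun n x => by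
    simp only [hZdef, mul_assoc, tsum_mul_left]
  have hw' : ∀ n, Summable fun ℓ => |(Real.sqrt (V n))⁻¹ * w n ℓ| := fun n => by
    simpa only [abs_mul] using (hw n).1.mul_left _
  have hZm := fun n => summable_weighted_and_measurable_tsum hX hXC (hw' n)
  simp_rw [← hZ] at hZm
  have hmom1 : ∀ n, ∫ x, Z n x ^ 1 ∂μ = 0 := fun n => by
    simp_rw [pow_one, hZ]
    rw [integral_tsum_weighted μ hX hXC (hw' n)]
    simp [integral_comp_action hT hfmeas, hf0]
  have hmom2 : ∀ n, ∫ x, Z n x ^ 2 ∂μ = ∫ t, normKernel (w n) t * specDensity a t := fun n => by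
    simp_rw [hZdef, mul_pow]
    rw [integral_const_mul, integral_tsum_weighted_sq μ hX hXC (hw n).1,
      integral_normKernel_mul_specDensity (hw n).1 hcorr, inv_pow, Real.sq_sqrt (hpos n).le]
    simp_rw [integral_mul_comp_action hT hfmeas hTadd]
  have hlim2 : Tendsto (fun n => ∫ x, Z n x ^ 2 ∂μ) atTop (𝓝 (∫ t, specDensity a t ∂ξ)) := by
    simp_rw [hmom2]
    exact hreg ⟨specDensity a, continuous_specDensity hcorr⟩
  have hnonneg : 0 ≤ ∫ t, specDensity a t ∂ξ :=
    ge_of_tendsto' hlim2 fun n => integral_nonneg fun x => sq_nonneg _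
  have hle : ∀ n r, r ≠ 0 → r ≤ 2 →
      (momentCumulant r fun k => ∫ x, Z n x ^ k ∂μ) = ∫ x, Z n x ^ r ∂μ := fun n r hr hr2 =>
    momentCumulant_of_le_two (m := fun k => ∫ x, Z n x ^ k ∂μ) (hmom1 n) hr hr2
  have hcum' : ∀ r, 3 ≤ r →
      Tendsto (fun n => momentCumulant r fun k => ∫ x, Z n x ^ k ∂μ) atTop (𝓝 0) := fun r hr => by
    refine (hcum r hr).congr fun n => ?_
    simp_rw [hZ]
    rw [← tsum_jointCumulant μ hX hXC (hw' n)]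
    have hpow : V n ^ ((r : ℝ) / 2) = Real.sqrt (V n) ^ r := by
      rw [Real.sqrt_eq_rpow, ← Real.rpow_mul_natCast (hpos n).le]
      congr 1
      ring
    simp_rw [Finset.prod_mul_distrib, Finset.prod_const, Finset.card_univ, Fintype.card_fin,
      mul_assoc, tsum_mul_left]
    rw [hpow, div_eq_inv_mul, inv_pow]
  refine tendsto_integral_comp_of_tendsto_moments μ
    (fun n => by simpa only [← hZ] using (hZm n).2.1)
    (fun n => ⟨_, (hZm n).2.2⟩) _ (fun k => ?_) g
  rcases eq_or_ne k 0 with rfl | hk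
  · simp
  refine tendsto_moments_of_tendsto_momentCumulant (fun n k => ∫ x, Z n x ^ k ∂μ)
    (fun k => ∫ x, x ^ k ∂gaussianReal 0 _) (fun r hr => ?_) k hk
  rw [momentCumulant_gaussianReal _ hr]
  obtain rfl | rfl | hr3 : r = 1 ∨ r = 2 ∨ 3 ≤ r := by omega
  · simp only [hle _ 1 one_ne_zero one_le_two, hmom1]
    simp
  · simpa [hle _ 2 two_ne_zero le_rfl, Real.coe_toNNReal _ hnonneg] using hlim2
  · simpa [show r ≠ 2 by omega] using hcum' r hr3
end
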